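/- arXiv:1802.09118 — 10 statements merged into one kernel-verified Lean document; each statement's English description precedes it below -/
import Mathlib

section
/- Let (f, w, p) be a processed-flow solution such that f(u,s) = 0 and f(t,u) = 0 for every u ∈ V. Then there exist finitely many triples (π_1, v_1, a_1), …, (π_k, v_k, a_k), where each π_i is a walk from s to t in which every vertex occurs at most twice, s occurs only as the first entry and t only as the last entry, v_i is an entry of π_i with v_i ∉ {s,t}, and a_i > 0, such that: (a) Σ_{i=1}^k a_i = Σ_u f(s,u) (the value of the solution); (b) for every ordered pair (u,u') ∈ V × V, Σ_i a_i · (number of occurrences of (u,u') as an edge of π_i) ≤ f(u,u'); (c) for every v ∈ V, Σ_{i : v_i = v} a_i ≤ p(v); and (d) k ≤ |V| + 2·|{(u,u') ∈ V × V : f(u,u') > 0}|. -/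
open Finset

/-- A processed-flow solution on a finite vertex set `V` with source `s`, sink `t`,
edge capacities `B` and vertex processing capacities `C`. -/
def IsPFS {V : Type*} [Fintype V] (s t : V) (B : V → V → ℝ) (C : V → ℝ)
    (f w : V → V → ℝ) (p : V → ℝ) : Prop :=
  (∀ u v, 0 ≤ w u v ∧ w u v ≤ f u v ∧ f u v ≤ B u v) ∧
  (∀ v, v ≠ s → v ≠ t → ∑ u, f u v = ∑ u, f v u) ∧
  (∀ v, v ≠ s → p v = ∑ u, w u v - ∑ u, w v u) ∧
  (∀ v, 0 ≤ p v ∧ p v ≤ C v) ∧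
  (∀ u, w s u = f s u) ∧
  (∀ u, w u t = 0)

/-- The consecutive pairs of a list. -/
def List.steps {α : Type*} (l : List α) : List (α × α) := l.zip l.tail

section Steps

variable {α : Type*}

@[simp] lemma List.steps_nil : ([] : List α).steps = [] := rfl

@[simp] lemma List.steps_singleton (x : α) : [x].steps = [] := rfl

@[simp] lemma List.steps_cons_cons (x y : α) (l : List α) :
    (x :: y :: l).steps = (x, y) :: (y :: l).steps := rfl

lemma List.steps_append_cons (l₁ l₂ : List α) (x : α) :
    (l₁ ++ x :: l₂).steps = (l₁ ++ [x]).steps ++ (x :: l₂).steps := by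
  induction l₁ with
  | nil => simp
  | cons y l₁ ih => cases l₁ <;> simp_all

lemma List.steps_append_cons_cons (l₁ l₂ : List α) (x y : α) :
    (l₁ ++ x :: y :: l₂).steps = (l₁ ++ [x]).steps ++ (x, y) :: (y :: l₂).steps := by
  rw [List.steps_append_cons, List.steps_cons_cons]

lemma List.steps_map {β : Type*} (g : α → β) (l : List α) :
    (l.map g).steps = l.steps.map (Prod.map g g) := by
  rw [List.steps, List.steps, ← List.map_tail, List.zip_map]

lemma List.IsChain.rel_of_mem_steps {R : α → α → Prop} {l : List α} (h : l.IsChain R)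
    {x y : α} (hxy : (x, y) ∈ l.steps) : R x y := by
  induction l with
  | nil => simp at hxy
  | cons z l ih =>
    cases l with
    | nil => simp at hxy
    | cons z' l =>
      rw [List.isChain_cons_cons] at h
      rw [List.steps_cons_cons, List.mem_cons] at hxy
      rcases hxy with hxy | hxy
      · cases hxy
        exact h.1
      · exact ih h.2 hxy

lemma List.IsChain.exists_rel_of_mem {R : α → α → Prop} {l : List α} {a : α}
    (h : (a :: l).IsChain R) {y : α} (hy : y ∈ l) : ∃ x, R x y := by
  induction l generalizing a with
  | nil => simp at hy
  | cons z l ih =>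
    rw [List.isChain_cons_cons] at h
    rcases List.mem_cons.1 hy with rfl | hy
    · exact ⟨a, h.1⟩
    · exact ih h.2 hy

lemma List.Nodup.steps {l : List α} (h : l.Nodup) : l.steps.Nodup := by
  refine List.Nodup.of_map Prod.snd ?_
  rw [List.steps, List.map_snd_zip (by simp)]
  exact h.sublist (List.tail_sublist l)

variable [BEq α] [LawfulBEq α]

lemma List.sum_count_steps_right [Fintype α] (l : List α) (v : α) :
    ∑ u, l.steps.count (u, v) = l.tail.count v := by
  induction l with
  | nil => simp
  | cons x l ih =>
    cases l with
    | nil => simp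
    | cons y l =>
      simp only [List.steps_cons_cons, List.count_cons, Finset.sum_add_distrib, ih,
        List.tail_cons]
      rw [Finset.sum_eq_single x (fun u _ hu => by simp [Ne.symm hu]) (by simp)]
      by_cases h : y = v <;> simp [h]

lemma List.sum_count_steps_left [Fintype α] (l : List α) (v : α) :
    ∑ u, l.steps.count (v, u) = l.dropLast.count v := by
  induction l with
  | nil => simp
  | cons x l ih =>
    cases l with
    | nil => simp
    | cons y l =>
      simp only [List.steps_cons_cons, List.count_cons, Finset.sum_add_distrib, ih,
        List.dropLast_cons_cons]
      rw [Finset.sum_eq_single y (fun u _ hu => by simp [Ne.symm hu]) (by simp)]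
      by_cases h : x = v <;> simp [h]

lemma Relation.ReflTransGen.exists_nodup_isChain {R : α → α → Prop} {a b : α}
    (h : Relation.ReflTransGen R a b) :
    ∃ l : List α, (a :: l).IsChain R ∧ (a :: l).Nodup ∧ (a :: l).getLast? = some b := by
  induction h using Relation.ReflTransGen.head_induction_on with
  | refl => exact ⟨[], by simp⟩
  | @head a c hac _ ih =>
    obtain ⟨l, hl, hnd, hlast⟩ := ih
    by_cases ha : a ∈ c :: l
    · obtain ⟨l₁, l₂, hl₂⟩ := List.append_of_mem ha
      rw [hl₂] at hl hnd hlast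
      exact ⟨l₂, hl.right_of_append, hnd.of_append_right, by simpa using hlast⟩
    · exact ⟨c :: l, List.isChain_cons_cons.2 ⟨hac, hl⟩, List.nodup_cons.2 ⟨ha, hnd⟩,
        by simpa using hlast⟩

end Steps

section ReduceAlong

variable {N : Type*} [BEq N]

/-- Subtract `δ` from `g` along each step of `l`. -/
def reduceAlong (g : N → N → ℝ) (l : List N) (δ : ℝ) (u v : N) : ℝ :=
  g u v - δ * (l.steps.count (u, v) : ℝ)

lemma reduceAlong_le (g : N → N → ℝ) (l : List N) {δ : ℝ} (hδ : 0 ≤ δ) (u v : N) :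
    reduceAlong g l δ u v ≤ g u v := by
  have : 0 ≤ δ * (l.steps.count (u, v) : ℝ) := by positivity
  simp only [reduceAlong]
  linarith

end ReduceAlong

instance Sum.instLawfulBEq {α β : Type*} [BEq α] [LawfulBEq α] [BEq β] [LawfulBEq β] :
    LawfulBEq (α ⊕ β) where
  eq_of_beq {x y} h := by
    rcases x with x | x <;> rcases y with y | y
    · exact congrArg _ (eq_of_beq (show (x == y) = true from h))
    · exact absurd (show false = true from h) (by simp)
    · exact absurd (show false = true from h) (by simp)
    · exact congrArg _ (eq_of_beq (show (x == y) = true from h))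
  rfl {x} := by
    rcases x with x | x
    · exact (show (x == x) = true from beq_self_eq_true x)
    · exact (show (x == x) = true from beq_self_eq_true x)

section FlowDecomposition

variable {N : Type*} [Fintype N]

/-- A nonnegative function on ordered pairs which is conserved away from `a` and `b`,
with nothing entering `a` and nothing leaving `b`. -/
structure IsFlow (a b : N) (g : N → N → ℝ) : Prop where
  nonneg : ∀ u v, 0 ≤ g u v
  conserved : ∀ v, v ≠ a → v ≠ b → ∑ u, g u v = ∑ u, g v u
  into_source : ∀ u, g u a = 0
  out_of_sink : ∀ u, g b u = 0

/-- The pairs carrying a positive amount. -/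
noncomputable def flowSupport (g : N → N → ℝ) : Finset (N × N) :=
  univ.filter fun e => 0 < g e.1 e.2

lemma IsFlow.reachable {a b : N} {g : N → N → ℝ} (hg : IsFlow a b g)
    (hpos : 0 < ∑ u, g a u) : Relation.ReflTransGen (fun u v => 0 < g u v) a b := by
  classical
  by_contra hb
  set R : Finset N := univ.filter (Relation.ReflTransGen (fun u v => 0 < g u v) a) with hR
  have haR : a ∈ R := by simp [hR, Relation.ReflTransGen.refl]
  have hout : ∀ v ∈ R, ∑ u, g v u = ∑ u ∈ R, g v u := by
    intro v hv
    refine (Finset.sum_subset (Finset.subset_univ R) fun u _ hu => ?_).symm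
    by_contra hne
    have hv' : Relation.ReflTransGen (fun u v => 0 < g u v) a v := by simpa [hR] using hv
    exact hu (by simpa [hR] using hv'.tail (lt_of_le_of_ne (hg.nonneg v u) (Ne.symm hne)))
  have hle : ∑ v ∈ R, ∑ u, g v u ≤ ∑ v ∈ R, ∑ u, g u v := by
    rw [Finset.sum_congr rfl hout, Finset.sum_comm]
    exact Finset.sum_le_sum fun v _ => Finset.sum_le_sum_of_subset_of_nonneg
      (Finset.subset_univ R) fun u _ _ => hg.nonneg u v
  have hlt : ∑ v ∈ R, ∑ u, g u v < ∑ v ∈ R, ∑ u, g v u := by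
    refine Finset.sum_lt_sum (fun v hv => ?_) ⟨a, haR, by simpa [hg.into_source] using hpos⟩
    by_cases hva : v = a
    · subst hva
      simpa [hg.into_source] using hpos.le
    · refine (hg.conserved v hva ?_).le
      rintro rfl
      exact hb (by simpa [hR] using hv)
  exact absurd hle hlt.not_ge

variable [BEq N] [LawfulBEq N]

lemma sum_reduceAlong_left (g : N → N → ℝ) (l : List N) (δ : ℝ) (v : N) :
    ∑ u, reduceAlong g l δ v u = ∑ u, g v u - δ * (l.dropLast.count v : ℝ) := by
  simp only [reduceAlong, Finset.sum_sub_distrib, ← Finset.mul_sum]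
  rw [← List.sum_count_steps_left, Nat.cast_sum]

lemma sum_reduceAlong_right (g : N → N → ℝ) (l : List N) (δ : ℝ) (v : N) :
    ∑ u, reduceAlong g l δ u v = ∑ u, g u v - δ * (l.tail.count v : ℝ) := by
  simp only [reduceAlong, Finset.sum_sub_distrib, ← Finset.mul_sum]
  rw [← List.sum_count_steps_right, Nat.cast_sum]

lemma IsFlow.isFlow_reduceAlong {a b : N} {g : N → N → ℝ} (hg : IsFlow a b g) {l : List N}
    (hnd : (a :: l).Nodup) (hlast : (a :: l).getLast? = some b) {δ : ℝ} (hδ : 0 ≤ δ)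
    (hmin : ∀ e ∈ (a :: l).steps, δ ≤ g e.1 e.2) :
    IsFlow a b (reduceAlong g (a :: l) δ) := by
  have hnn : ∀ u v, 0 ≤ reduceAlong g (a :: l) δ u v := by
    intro u v
    unfold reduceAlong
    by_cases h : (u, v) ∈ (a :: l).steps
    · rw [List.count_eq_one_of_mem hnd.steps h]
      simpa using hmin _ h
    · rw [List.count_eq_zero_of_not_mem h]
      simpa using hg.nonneg u v
  refine ⟨hnn, fun v hva hvb => ?_, fun u => ?_, fun u => ?_⟩
  · rw [sum_reduceAlong_left, sum_reduceAlong_right, hg.conserved v hva hvb]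
    have h₁ : (a :: l).count v = (a :: l).tail.count v := by
      simp [Ne.symm hva]
    have h₂ : (a :: l).count v = (a :: l).dropLast.count v := by
      conv_lhs => rw [← List.dropLast_append_getLast? b hlast]
      simp [Ne.symm hvb]
    rw [← h₁, h₂]
  · exact le_antisymm ((reduceAlong_le g _ hδ u a).trans (hg.into_source u).le) (hnn u a)
  · exact le_antisymm ((reduceAlong_le g _ hδ b u).trans (hg.out_of_sink u).le) (hnn b u)

theorem IsFlow.exists_decomposition {a b : N} (hab : a ≠ b) {g : N → N → ℝ}
    (hg : IsFlow a b g) :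
    ∃ (k : ℕ) (P : Fin k → List N) (c : Fin k → ℝ),
      (∀ i, (a :: P i).IsChain (fun u v => 0 < g u v) ∧ (a :: P i).Nodup ∧
        (a :: P i).getLast? = some b ∧ 0 < c i) ∧
      ∑ i, c i = ∑ u, g a u ∧
      (∀ u v, ∑ i, c i * ((a :: P i).steps.count (u, v) : ℝ) ≤ g u v) ∧
      k ≤ (flowSupport g).card := by
  classical
  induction hn : (flowSupport g).card using Nat.strong_induction_on generalizing g with
  | _ n ih =>
  rcases (Finset.sum_nonneg fun u _ => hg.nonneg a u).eq_or_lt with h0 | hpos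
  · exact ⟨0, Fin.elim0, Fin.elim0, fun i => i.elim0, by simpa using h0,
      by simpa using hg.nonneg, Nat.zero_le _⟩
  obtain ⟨l, hchain, hnd, hlast⟩ := (hg.reachable hpos).exists_nodup_isChain
  have hne : (a :: l).steps.toFinset.Nonempty := by
    cases l with
    | nil => simp_all
    | cons y l => exact ⟨(a, y), by simp⟩
  obtain ⟨e, he, hmin⟩ := Finset.exists_min_image _ (fun e : N × N => g e.1 e.2) hne
  simp only [List.mem_toFinset] at he hmin
  have hδ : 0 < g e.1 e.2 := hchain.rel_of_mem_steps he
  set δ := g e.1 e.2 with hδdef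
  set g' := reduceAlong g (a :: l) δ with hg'
  have hle : ∀ u v, g' u v ≤ g u v := reduceAlong_le g _ hδ.le
  have hcard : (flowSupport g').card < n := by
    rw [← hn]
    refine Finset.card_lt_card (Finset.ssubset_iff_subset_ne.2 ⟨fun x hx => ?_, fun heq => ?_⟩)
    · simp only [flowSupport, Finset.mem_filter, Finset.mem_univ, true_and] at hx ⊢
      exact hx.trans_le (hle _ _)
    · have hmem : e ∈ flowSupport g' := by
        rw [heq]
        simpa [flowSupport] using hδ
      simp [flowSupport, hg', reduceAlong, List.count_eq_one_of_mem hnd.steps he,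
        ← hδdef] at hmem
  obtain ⟨k, P, c, hP, hsum, hedge, hk⟩ :=
    ih _ hcard (hg.isFlow_reduceAlong hnd hlast hδ.le hmin) rfl
  refine ⟨k + 1, Fin.cons l P, Fin.cons δ c, ?_, ?_, fun u v => ?_, by omega⟩
  · refine Fin.cases ⟨hchain, hnd, hlast, hδ⟩ fun i => ?_
    obtain ⟨h₁, h₂, h₃, h₄⟩ := hP i
    exact ⟨h₁.imp fun u v h => h.trans_le (hle u v), h₂, h₃, h₄⟩
  · have hcount : (a :: l).dropLast.count a = 1 := by
      cases l with
      | nil => simp_all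
      | cons y l =>
        rw [List.dropLast_cons_cons]
        refine List.count_eq_one_of_mem ?_ (by simp)
        rw [← List.dropLast_cons_cons]
        exact hnd.sublist (List.dropLast_sublist _)
    rw [Fin.sum_univ_succ]
    simp only [Fin.cons_zero, Fin.cons_succ]
    rw [hsum, sum_reduceAlong_left, hcount]
    simp
  · rw [Fin.sum_univ_succ]
    simp only [Fin.cons_zero, Fin.cons_succ]
    have := hedge u v
    simp only [reduceAlong] at this
    linarith

end FlowDecomposition

section Layered

variable {V : Type*}

open Classical in
/-- The two-layer network of a processed flow: the left layer carries unprocessed flow, the right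
layer processed flow, and processing at `v` moves flow from `inl v` to `inr v`. -/
noncomputable def layeredFlow (s : V) (f w : V → V → ℝ) (p : V → ℝ) : V ⊕ V → V ⊕ V → ℝ
  | .inl u, .inl v => w u v
  | .inr u, .inr v => f u v - w u v
  | .inl u, .inr v => if u = v ∧ u ≠ s then p u else 0
  | .inr _, .inl _ => 0

lemma sum_layeredFlow_inl_inr_right [Fintype V] {s v : V} (f w : V → V → ℝ) (p : V → ℝ)
    (hv : v ≠ s) : ∑ u, layeredFlow s f w p (.inl u) (.inr v) = p v := by
  rw [Finset.sum_eq_single v] <;> simp +contextual [layeredFlow, hv]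

lemma sum_layeredFlow_inl_inr_left [Fintype V] {s v : V} (f w : V → V → ℝ) (p : V → ℝ)
    (hv : v ≠ s) : ∑ u, layeredFlow s f w p (.inl v) (.inr u) = p v := by
  rw [Finset.sum_eq_single v] <;> simp +contextual [layeredFlow, hv, eq_comm]

lemma IsPFS.isFlow_layeredFlow [Fintype V] {s t : V} {B : V → V → ℝ} {C : V → ℝ}
    {f w : V → V → ℝ} {p : V → ℝ} (hsol : IsPFS s t B C f w p)
    (hins : ∀ u, f u s = 0) (houtt : ∀ u, f t u = 0) :
    IsFlow (.inl s) (.inr t) (layeredFlow s f w p) := by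
  obtain ⟨hw, hf, hp, hpC, hws, hwt⟩ := hsol
  have hwzero : ∀ u v, f u v = 0 → w u v = 0 := fun u v h =>
    le_antisymm ((hw u v).2.1.trans h.le) (hw u v).1
  refine ⟨?_, ?_, ?_, ?_⟩
  · rintro (u | u) (v | v)
    · exact (hw u v).1
    · simp only [layeredFlow]
      split_ifs
      exacts [(hpC u).1, le_rfl]
    · exact le_rfl
    · exact sub_nonneg.2 (hw u v).2.1
  · rintro (v | v) hvs hvt
    · have hv : v ≠ s := fun h => hvs (h ▸ rfl)
      rw [Fintype.sum_sum_type, Fintype.sum_sum_type, sum_layeredFlow_inl_inr_left f w p hv]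
      simp only [layeredFlow, hp v hv, Finset.sum_const_zero]
      ring
    · have hv : v ≠ t := fun h => hvt (h ▸ rfl)
      rw [Fintype.sum_sum_type, Fintype.sum_sum_type]
      by_cases hs : v = s
      · subst hs
        simp [layeredFlow, hins, hwzero _ _ (hins _), hws]
      · rw [sum_layeredFlow_inl_inr_right f w p hs]
        simp only [layeredFlow, Finset.sum_sub_distrib, hp v hs, hf v hs hv,
          Finset.sum_const_zero]
        ring
  · rintro (u | u)
    · exact hwzero _ _ (hins u)
    · rfl
  · rintro (u | u)
    · rfl
    · simp [layeredFlow, houtt, hwzero _ _ (houtt u)]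

lemma card_flowSupport_layeredFlow_le [Fintype V] {s : V} {f w : V → V → ℝ} {p : V → ℝ}
    (hw : ∀ u v, 0 ≤ w u v ∧ w u v ≤ f u v) :
    (flowSupport (layeredFlow s f w p)).card ≤ Fintype.card V + 2 * (flowSupport f).card := by
  classical
  simp only [flowSupport, Finset.card_filter, Fintype.sum_prod_type, Fintype.sum_sum_type,
    Finset.sum_add_distrib]
  have h₁ : ∑ u, ∑ v, (if 0 < layeredFlow s f w p (.inl u) (.inl v) then 1 else 0) ≤
      ∑ u, ∑ v, if 0 < f u v then 1 else 0 := by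
    refine Finset.sum_le_sum fun u _ => Finset.sum_le_sum fun v _ => ?_
    have := hw u v
    by_cases h : 0 < w u v
    · simp [layeredFlow, h, h.trans_le this.2]
    · simp [layeredFlow, h]
  have h₂ : ∑ u, ∑ v, (if 0 < layeredFlow s f w p (.inr u) (.inr v) then 1 else 0) ≤
      ∑ u, ∑ v, if 0 < f u v then 1 else 0 := by
    refine Finset.sum_le_sum fun u _ => Finset.sum_le_sum fun v _ => ?_
    have := hw u v
    by_cases h : 0 < f u v - w u v
    · have hf : 0 < f u v := by linarith
      simp [layeredFlow, h, hf]
    · simp only [layeredFlow, h, if_false]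
      positivity
  have h₃ : ∑ u, ∑ v, (if 0 < layeredFlow s f w p (.inl u) (.inr v) then 1 else 0) ≤
      Fintype.card V := by
    calc _ ≤ ∑ u : V, ∑ v : V, if u = v then 1 else 0 := by
          refine Finset.sum_le_sum fun u _ => Finset.sum_le_sum fun v _ => ?_
          simp only [layeredFlow]
          by_cases h : u = v <;> simp [h]
          split_ifs <;> omega
      _ = Fintype.card V := by simp
  have h₄ : ∑ u, ∑ v, (if 0 < layeredFlow s f w p (.inr u) (.inl v) then 1 else 0) = 0 := by
    simp [layeredFlow]
  omega

lemma exists_eq_map_inl_append_map_inr {s : V} {f w : V → V → ℝ} {p : V → ℝ} {t : V}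
    {l : List (V ⊕ V)} {a : V}
    (hl : (.inl a :: l).IsChain fun u v => 0 < layeredFlow s f w p u v)
    (hlast : (.inl a :: l).getLast? = some (.inr t)) :
    ∃ (l₁ : List V) (x : V) (l₂ : List V),
      .inl a :: l = (l₁ ++ [x]).map .inl ++ (x :: l₂).map .inr := by
  have hright : ∀ (l : List (V ⊕ V)) (x : V),
      ((.inr x :: l).IsChain fun u v => 0 < layeredFlow s f w p u v) →
      ∃ l₂ : List V, l = l₂.map .inr := by
    intro l
    induction l with
    | nil => exact fun _ _ => ⟨[], rfl⟩
    | cons y l ih =>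
      intro x h
      rw [List.isChain_cons_cons] at h
      rcases y with y | y
      · exact absurd h.1 (lt_irrefl _)
      · obtain ⟨l₂, rfl⟩ := ih y h.2
        exact ⟨y :: l₂, rfl⟩
  induction l generalizing a with
  | nil => simp at hlast
  | cons y l ih =>
    rw [List.isChain_cons_cons] at hl
    rcases y with y | y
    · obtain ⟨l₁, x, l₂, h⟩ := ih hl.2 (by simpa using hlast)
      exact ⟨a :: l₁, x, l₂, by simp [h]⟩
    · obtain ⟨l₂, rfl⟩ := hright l y hl.2
      have hay : a = y := by
        by_contra hne
        exact absurd hl.1 (by simp [layeredFlow, hne])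
      subst hay
      exact ⟨[], a, l₂, rfl⟩

lemma steps_layered (l₁ l₂ : List V) (x : V) :
    ((l₁ ++ [x]).map .inl ++ (x :: l₂).map .inr : List (V ⊕ V)).steps =
      (l₁ ++ [x]).steps.map (Prod.map .inl .inl) ++
        (.inl x, .inr x) :: (x :: l₂).steps.map (Prod.map .inr .inr) := by
  rw [← List.steps_map, ← List.steps_map]
  simp [List.steps_append_cons_cons]

variable [DecidableEq V]

lemma count_steps_layered (l₁ l₂ : List V) (x u v : V) :
    ((l₁ ++ [x]).map .inl ++ (x :: l₂).map .inr : List (V ⊕ V)).steps.count (.inl u, .inl v) +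
      ((l₁ ++ [x]).map .inl ++ (x :: l₂).map .inr : List (V ⊕ V)).steps.count (.inr u, .inr v) =
      (l₁ ++ x :: l₂).steps.count (u, v) := by
  have hl (L : List (V × V)) : (L.map (Prod.map Sum.inl Sum.inl)).count
      ((.inl u, .inl v) : (V ⊕ V) × (V ⊕ V)) = L.count (u, v) :=
    List.count_map_of_injective L _ (Sum.inl_injective.prodMap Sum.inl_injective) (u, v)
  have hr (L : List (V × V)) : (L.map (Prod.map Sum.inr Sum.inr)).count
      ((.inr u, .inr v) : (V ⊕ V) × (V ⊕ V)) = L.count (u, v) :=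
    List.count_map_of_injective L _ (Sum.inr_injective.prodMap Sum.inr_injective) (u, v)
  have hl₀ (L : List (V × V)) : (L.map (Prod.map Sum.inr Sum.inr)).count
      ((.inl u, .inl v) : (V ⊕ V) × (V ⊕ V)) = 0 := List.count_eq_zero_of_not_mem (by simp)
  have hr₀ (L : List (V × V)) : (L.map (Prod.map Sum.inl Sum.inl)).count
      ((.inr u, .inr v) : (V ⊕ V) × (V ⊕ V)) = 0 := List.count_eq_zero_of_not_mem (by simp)
  rw [steps_layered, List.steps_append_cons l₁ l₂]
  simp only [List.count_append, List.count_cons, hl, hr, hl₀, hr₀]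
  simp

lemma count_steps_layered_vertical (l₁ l₂ : List V) (x : V) :
    ((l₁ ++ [x]).map .inl ++ (x :: l₂).map .inr : List (V ⊕ V)).steps.count (.inl x, .inr x) =
      1 := by
  have h₁ : ((l₁ ++ [x]).steps.map (Prod.map Sum.inl Sum.inl)).count
      ((.inl x, .inr x) : (V ⊕ V) × (V ⊕ V)) = 0 := List.count_eq_zero_of_not_mem (by simp)
  have h₂ : ((x :: l₂).steps.map (Prod.map Sum.inr Sum.inr)).count
      ((.inl x, .inr x) : (V ⊕ V) × (V ⊕ V)) = 0 := List.count_eq_zero_of_not_mem (by simp)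
  rw [steps_layered, List.count_append, List.count_cons_self, h₁, h₂]

lemma projected_walk_properties {s t : V} {f w : V → V → ℝ} {p : V → ℝ}
    (hst : s ≠ t)
    (hwt : ∀ u, w u t = 0) (hrs₀ : ∀ u, f u s - w u s = 0) {l₁ l₂ : List V} {x : V} {l : List (V ⊕ V)}
    (heq : .inl s :: l = (l₁ ++ [x]).map .inl ++ (x :: l₂).map .inr)
    (hchain : (.inl s :: l).IsChain fun u v => 0 < layeredFlow s f w p u v)
    (hnd : (.inl s :: l).Nodup) (hlast : (.inl s :: l).getLast? = some (.inr t)) :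
    2 ≤ (l₁ ++ x :: l₂).length ∧ (l₁ ++ x :: l₂).head? = some s ∧
      (l₁ ++ x :: l₂).getLast? = some t ∧ (l₁ ++ x :: l₂).count s = 1 ∧
      (l₁ ++ x :: l₂).count t = 1 ∧ (∀ y, (l₁ ++ x :: l₂).count y ≤ 2) ∧
      x ∈ l₁ ++ x :: l₂ ∧ x ≠ s ∧ x ≠ t := by
  have hrs : (.inr s : V ⊕ V) ∉ .inl s :: l := by
    intro h
    obtain ⟨y, hy⟩ := hchain.exists_rel_of_mem (by simpa using h)
    rcases y with y | y
    · have h0 : layeredFlow s f w p (.inl y) (.inr s) = 0 := if_neg fun h => h.2 h.1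
      exact hy.ne' h0
    · exact hy.ne' (hrs₀ y)
  have hlt : (.inl t : V ⊕ V) ∉ .inl s :: l := by
    intro h
    obtain ⟨y, hy⟩ := hchain.exists_rel_of_mem (by simpa [hst.symm] using h)
    rcases y with y | y
    · exact hy.ne' (hwt y)
    · exact lt_irrefl _ hy
  rw [heq] at hrs hlt hnd
  have hxs : x ≠ s := by
    rintro rfl
    simp at hrs
  have hxt : x ≠ t := by
    rintro rfl
    simp at hlt
  have hnd₁ : (l₁ ++ [x]).Nodup := hnd.of_append_left.of_map
  have hnd₂ : (x :: l₂).Nodup := hnd.of_append_right.of_map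
  have hs₂ : s ∉ l₂ := fun h => hrs (by simp [h])
  have ht₁ : t ∉ l₁ := fun h => hlt (by simp [h])
  have hlast' : (x :: l₂).getLast? = some t := by
    rw [heq, List.getLast?_append_of_ne_nil _ (by simp), List.getLast?_map] at hlast
    simpa using hlast
  obtain ⟨l₁, rfl⟩ : ∃ l₁', l₁ = s :: l₁' := by
    cases l₁ with
    | nil => simp_all
    | cons y l₁ => simp_all
  have ht₂ : t ∈ l₂ := by
    have := List.mem_of_getLast? hlast'
    simpa [hxt.symm] using this
  refine ⟨by simp; omega, rfl, ?_, ?_, ?_, fun y => ?_, by simp, hxs, hxt⟩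
  · rwa [List.getLast?_append_of_ne_nil _ (by simp)]
  · rw [List.count_append, List.count_eq_one_of_mem hnd₁.of_append_left (by simp),
      List.count_eq_zero_of_not_mem (by simp [hxs.symm, hs₂])]
  · rw [List.count_append, List.count_eq_zero_of_not_mem ht₁,
      List.count_eq_one_of_mem hnd₂ (by simp [ht₂])]
  · rw [List.count_append]
    have h₁ := List.nodup_iff_count_le_one.1 hnd₁.of_append_left y
    have h₂ := List.nodup_iff_count_le_one.1 hnd₂ y
    omega

end Layered

theorem stmt0 {V : Type*} [Fintype V] [DecidableEq V]
    (s t : V) (hst : s ≠ t) (B : V → V → ℝ) (C : V → ℝ)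
    (hB : ∀ u v, 0 ≤ B u v) (hC : ∀ v, 0 ≤ C v)
    (f w : V → V → ℝ) (p : V → ℝ)
    (hsol : IsPFS s t B C f w p)
    (hins : ∀ u, f u s = 0) (houtt : ∀ u, f t u = 0) :
    ∃ (k : ℕ) (π : Fin k → List V) (vx : Fin k → V) (a : Fin k → ℝ),
      (∀ i, 2 ≤ (π i).length ∧ (π i).head? = some s ∧ (π i).getLast? = some t ∧
        (π i).count s = 1 ∧ (π i).count t = 1 ∧ (∀ x, (π i).count x ≤ 2) ∧
        vx i ∈ π i ∧ vx i ≠ s ∧ vx i ≠ t ∧ 0 < a i) ∧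
      (∑ i, a i = ∑ u, f s u) ∧
      (∀ u u', ∑ i, a i * (((π i).zip (π i).tail).count (u, u') : ℝ) ≤ f u u') ∧
      (∀ v, ∑ i ∈ univ.filter (fun i => vx i = v), a i ≤ p v) ∧
      k ≤ Fintype.card V +
        2 * ((univ : Finset (V × V)).filter (fun e => 0 < f e.1 e.2)).card := by
  have hg := hsol.isFlow_layeredFlow hins houtt
  obtain ⟨hw, -, -, hpC, hws, hwt⟩ := hsol
  have hwf : ∀ u v, 0 ≤ w u v ∧ w u v ≤ f u v := fun u v => ⟨(hw u v).1, (hw u v).2.1⟩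
  have hrs : ∀ u, f u s - w u s = 0 := fun u => by
    have := hwf u s
    rw [hins] at this ⊢
    linarith [this.1, this.2]
  obtain ⟨k, P, c, hP, hsum, hedge, hk⟩ := hg.exists_decomposition Sum.inl_ne_inr
  choose l₁ x l₂ heq using fun i => exists_eq_map_inl_append_map_inr (hP i).1 (hP i).2.2.1
  have hwalk := fun i => projected_walk_properties hst hwt hrs (heq i) (hP i).1 (hP i).2.1
    (hP i).2.2.1
  refine ⟨k, fun i => l₁ i ++ x i :: l₂ i, x, c, fun i => ?_, ?_, fun u u' => ?_, fun v => ?_,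
    hk.trans (card_flowSupport_layeredFlow_le hwf)⟩
  · obtain ⟨h₁, h₂, h₃, h₄, h₅, h₆, h₇, h₈, h₉⟩ := hwalk i
    exact ⟨h₁, h₂, h₃, h₄, h₅, h₆, h₇, h₈, h₉, (hP i).2.2.2⟩
  · rw [hsum, Fintype.sum_sum_type]
    simp [layeredFlow, hws]
  · calc _ = ∑ i, c i * ((.inl s :: P i).steps.count (.inl u, .inl u') : ℝ) +
          ∑ i, c i * ((.inl s :: P i).steps.count (.inr u, .inr u') : ℝ) := by
          rw [← Finset.sum_add_distrib]
          refine Finset.sum_congr rfl fun i _ => ?_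
          rw [heq i, ← mul_add, ← Nat.cast_add, count_steps_layered]
          rfl
      _ ≤ w u u' + (f u u' - w u u') :=
          add_le_add (hedge (.inl u) (.inl u')) (hedge (.inr u) (.inr u'))
      _ = f u u' := by ring
  · calc _ ≤ ∑ i, c i * ((.inl s :: P i).steps.count (.inl v, .inr v) : ℝ) := by
          rw [Finset.sum_filter]
          refine Finset.sum_le_sum fun i _ => ?_
          split_ifs with h
          · rw [heq i, ← h, count_steps_layered_vertical]
            simp
          · exact mul_nonneg (hP i).2.2.2.le (Nat.cast_nonneg _)
      _ ≤ layeredFlow s f w p (.inl v) (.inr v) := hedge _ _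
      _ ≤ p v := by
          simp only [layeredFlow]
          split_ifs
          exacts [le_rfl, (hpC v).1]
end

section
/- Let (π_1, m_1, a_1), …, (π_k, m_k, a_k) be finitely many triples where each π_i = [x_0^i, …, x_{L_i}^i] is a walk from s to t with L_i ≥ 2 in which s occurs only as the first entry and t only as the last entry, m_i is an index with 1 ≤ m_i ≤ L_i − 1, and a_i ≥ 0. Define f(u,u') := Σ_i a_i · (number of indices j with (x_j^i, x_{j+1}^i) = (u,u')), w(u,u') := Σ_i a_i · (number of indices j < m_i with (x_j^i, x_{j+1}^i) = (u,u')), and p(v) := Σ_{i : x_{m_i}^i = v} a_i. If f(u,u') ≤ B(u,u') for all u, u' and p(v) ≤ C(v) for all v, then (f, w, p) is a processed-flow solution whose value Σ_u f(s,u) equals Σ_{i=1}^k a_i. -/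
open Finset

theorem sum_count_prodMk_right {V : Type*} [Fintype V] [DecidableEq V]
    (L : List (V × V)) (v : V) : ∑ u, L.count (u, v) = (L.map Prod.snd).count v := by
  induction L with
  | nil => simp
  | cons e L ih =>
    obtain ⟨x, y⟩ := e
    simp only [List.count_cons, List.map_cons, sum_add_distrib, ih, beq_iff_eq, Prod.mk.injEq]
    by_cases h : y = v <;> simp [h]

theorem sum_count_prodMk_left {V : Type*} [Fintype V] [DecidableEq V]
    (L : List (V × V)) (v : V) : ∑ u, L.count (v, u) = (L.map Prod.fst).count v := by
  induction L with
  | nil => simp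
  | cons e L ih =>
    obtain ⟨x, y⟩ := e
    simp only [List.count_cons, List.map_cons, sum_add_distrib, ih, beq_iff_eq, Prod.mk.injEq]
    by_cases h : x = v <;> simp [h]

theorem map_fst_take_zip_tail {V : Type*} (l : List V) (n : ℕ) (hn : n < l.length) :
    ((l.zip l.tail).take n).map Prod.fst = l.take n := by
  rw [List.zip, List.take_zipWith, ← List.zip, List.map_fst_zip]
  grind

theorem map_snd_take_zip_tail {V : Type*} (l : List V) (n : ℕ) :
    ((l.zip l.tail).take n).map Prod.snd = l.tail.take n := by
  rw [List.zip, List.take_zipWith, ← List.zip, List.map_snd_zip]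
  simp

/-- Along an initial piece of a walk starting at `s` and avoiding `v` at its start, the number
of entries to `v` exceeds the number of exits by one exactly when the piece ends at `v`. -/
theorem sum_count_take_balance {V : Type*} [Fintype V] [DecidableEq V]
    (s : V) (l : List V) (hs : l.head? = some s) (n : ℕ) (hn : n < l.length) (v : V)
    (hv : v ≠ s) :
    ∑ u, ((l.zip l.tail).take n).count (u, v) =
      ∑ u, ((l.zip l.tail).take n).count (v, u) + if l.getD n s = v then 1 else 0 := by
  rw [sum_count_prodMk_right, sum_count_prodMk_left, map_fst_take_zip_tail l n hn,
    map_snd_take_zip_tail]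
  have h1 : (l.take (n + 1)).count v = (l.tail.take n).count v := by
    cases l with
    | nil => simp at hs
    | cons x l =>
      simp only [List.head?_cons, Option.some.injEq] at hs
      simp [hs, hv.symm]
  rw [← h1, List.take_succ_eq_append_getElem hn, List.count_append, List.count_singleton]
  simp [List.getElem?_eq_getElem hn]

theorem count_tail_eq_zero {V : Type*} [DecidableEq V] {s : V} {l : List V}
    (hs : l.head? = some s) (hc : l.count s = 1) : l.tail.count s = 0 := by
  cases l with
  | nil => simp at hs
  | cons x l =>
    simp only [List.head?_cons, Option.some.injEq] at hs
    simpa [hs] using hc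

theorem count_dropLast_eq_zero {V : Type*} [DecidableEq V] {t : V} {l : List V}
    (ht : l.getLast? = some t) (hc : l.count t = 1) : l.dropLast.count t = 0 := by
  obtain ⟨d, rfl⟩ := List.getLast?_eq_some_iff.1 ht
  simpa using hc

theorem take_length_sub_one_zip_tail {V : Type*} (l : List V) :
    (l.zip l.tail).take (l.length - 1) = l.zip l.tail :=
  List.take_of_length_le (by simp)

theorem sum_count_zip_tail_balance {V : Type*} [Fintype V] [DecidableEq V]
    {s t : V} {l : List V} (hs : l.head? = some s) (ht : l.getLast? = some t) {v : V}
    (hvs : v ≠ s) (hvt : v ≠ t) :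
    ∑ u, (l.zip l.tail).count (u, v) = ∑ u, (l.zip l.tail).count (v, u) := by
  have hl : 0 < l.length := by
    cases l with
    | nil => simp at hs
    | cons x l => simp
  have h := sum_count_take_balance s l hs (l.length - 1) (by omega) v hvs
  have hlast : l.getD (l.length - 1) s = t := by
    rw [List.getLast?_eq_getElem?] at ht
    simp [List.getD, ht]
  rwa [take_length_sub_one_zip_tail, hlast, if_neg hvt.symm, add_zero] at h

theorem count_take_zip_tail_source {V : Type*} [DecidableEq V] {s : V} {l : List V}
    (hs : l.head? = some s) (hc : l.count s = 1) {m : ℕ} (hm : 1 ≤ m) (u : V) :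
    ((l.zip l.tail).take m).count (s, u) = (l.zip l.tail).count (s, u) := by
  conv_rhs => rw [← List.take_append_drop m (l.zip l.tail), List.count_append]
  rw [left_eq_add, List.count_eq_zero]
  intro h
  rw [List.zip, List.drop_zipWith, ← List.zip] at h
  have h1 := (List.of_mem_zip h).1
  refine List.count_eq_zero.1 (count_tail_eq_zero hs hc) ?_
  rw [← List.drop_one]
  exact List.drop_subset_drop_left l hm h1

theorem count_take_zip_tail_sink {V : Type*} [DecidableEq V] {t : V} {l : List V}
    (ht : l.getLast? = some t) (hc : l.count t = 1) {m : ℕ} (hm : m + 2 ≤ l.length) (u : V) :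
    ((l.zip l.tail).take m).count (u, t) = 0 := by
  rw [List.count_eq_zero]
  intro h
  have h1 : t ∈ l.tail.take m := by
    rw [← map_snd_take_zip_tail]
    exact List.mem_map_of_mem h
  refine List.count_eq_zero.1 (count_dropLast_eq_zero ht hc) ?_
  rw [← List.drop_one, List.take_drop] at h1
  rw [List.dropLast_eq_take]
  exact (List.take_subset_take_left l (by omega)) (List.mem_of_mem_drop h1)

theorem sum_count_zip_tail_source {V : Type*} [Fintype V] [DecidableEq V]
    {s t : V} (hst : s ≠ t) {l : List V} (ht : l.getLast? = some t) (hc : l.count s = 1) :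
    ∑ u, (l.zip l.tail).count (s, u) = 1 := by
  obtain ⟨d, rfl⟩ := List.getLast?_eq_some_iff.1 ht
  rw [← take_length_sub_one_zip_tail, sum_count_prodMk_left,
    map_fst_take_zip_tail _ _ (by simp)]
  simpa [hst.symm] using hc

/-- Exchanging the sum over vertices with the sum over weighted walks. -/
theorem sum_sum_mul_count {V ι : Type*} [Fintype V] [Fintype ι] (a : ι → ℝ) (c : ι → V → ℕ) :
    ∑ u, ∑ i, a i * (c i u : ℝ) = ∑ i, a i * ((∑ u, c i u : ℕ) : ℝ) := by
  rw [sum_comm]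
  simp [mul_sum]

theorem stmt1 {V : Type*} [Fintype V] [DecidableEq V]
    (s t : V) (hst : s ≠ t) (B : V → V → ℝ) (C : V → ℝ)
    (hB : ∀ u v, 0 ≤ B u v) (hC : ∀ v, 0 ≤ C v)
    (k : ℕ) (π : Fin k → List V) (m : Fin k → ℕ) (a : Fin k → ℝ)
    -- each `π i` is a walk from `s` to `t` with at least two edges (`L_i ≥ 2`),
    -- in which `s` occurs only as the first entry and `t` only as the last entry
    (hwalk : ∀ i, 3 ≤ (π i).length ∧ (π i).head? = some s ∧ (π i).getLast? = some t ∧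
      (π i).count s = 1 ∧ (π i).count t = 1)
    -- `1 ≤ m_i ≤ L_i - 1`, i.e. the processing entry is neither the first nor the last
    (hm : ∀ i, 1 ≤ m i ∧ m i ≤ (π i).length - 2)
    (ha : ∀ i, 0 ≤ a i)
    -- the induced flow respects the edge capacities
    (hcapB : ∀ u u',
      (∑ i, a i * (((π i).zip (π i).tail).count (u, u') : ℝ)) ≤ B u u')
    -- the induced processing respects the vertex capacities
    (hcapC : ∀ v,
      (∑ i ∈ univ.filter (fun i => (π i).getD (m i) s = v), a i) ≤ C v) :
    IsPFS s t B C
      (fun u u' => ∑ i, a i * (((π i).zip (π i).tail).count (u, u') : ℝ))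
      (fun u u' => ∑ i, a i * ((((π i).zip (π i).tail).take (m i)).count (u, u') : ℝ))
      (fun v => ∑ i ∈ univ.filter (fun i => (π i).getD (m i) s = v), a i) ∧
    (∑ u, ∑ i, a i * (((π i).zip (π i).tail).count (s, u) : ℝ)) = ∑ i, a i := by
  refine ⟨⟨fun u v => ⟨?_, ?_, hcapB u v⟩, fun v hvs hvt => ?_, fun v hvs => ?_,
    fun v => ⟨sum_nonneg fun i _ => ha i, hcapC v⟩, fun u => ?_, fun u => ?_⟩, ?_⟩
  · exact sum_nonneg fun i _ => mul_nonneg (ha i) (Nat.cast_nonneg _)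
  · refine sum_le_sum fun i _ => mul_le_mul_of_nonneg_left ?_ (ha i)
    exact_mod_cast (List.take_sublist _ _).count_le _
  · rw [sum_sum_mul_count a fun i u => ((π i).zip (π i).tail).count (u, v),
      sum_sum_mul_count a fun i u => ((π i).zip (π i).tail).count (v, u)]
    refine sum_congr rfl fun i _ => ?_
    rw [sum_count_zip_tail_balance (hwalk i).2.1 (hwalk i).2.2.1 hvs hvt]
  · rw [sum_sum_mul_count a fun i u => (((π i).zip (π i).tail).take (m i)).count (u, v),
      sum_sum_mul_count a fun i u => (((π i).zip (π i).tail).take (m i)).count (v, u),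
      ← sum_sub_distrib]
    simp only [sum_filter]
    refine sum_congr rfl fun i _ => ?_
    have hlt : m i < (π i).length := by
      have := hwalk i
      have := hm i
      omega
    rw [sum_count_take_balance s (π i) (hwalk i).2.1 (m i) hlt v hvs]
    split_ifs <;> push_cast <;> ring
  · refine sum_congr rfl fun i _ => ?_
    rw [count_take_zip_tail_source (hwalk i).2.1 (hwalk i).2.2.2.1 (hm i).1]
  · refine sum_eq_zero fun i _ => ?_
    have hle : m i + 2 ≤ (π i).length := by
      have := hwalk i
      have := hm i
      omega
    rw [count_take_zip_tail_sink (hwalk i).2.2.1 (hwalk i).2.2.2.2 hle]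
    simp
  · rw [sum_sum_mul_count a fun i u => ((π i).zip (π i).tail).count (s, u)]
    refine sum_congr rfl fun i _ => ?_
    rw [sum_count_zip_tail_source hst (hwalk i).2.2.1 (hwalk i).2.2.2.1]
    simp
end

section
/- Let (f, w, p) be a processed-flow solution and let v_0, …, v_{k−1} (k ≥ 2) be pairwise distinct vertices such that w(v_j, v_{j+1 mod k}) > 0 for every j. Let m := min_j w(v_j, v_{j+1 mod k}), and define f' and w' by subtracting m from both f and w on each cycle edge (v_j, v_{j+1 mod k}) and leaving them unchanged on all other pairs. Then (f', w', p) is again a processed-flow solution, and the net source flow is unchanged: Σ_u f'(s,u) − Σ_u f'(u,s) = Σ_u f(s,u) − Σ_u f(u,s). -/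
open Finset

theorem sum_range_succ_mod {M : Type*} [AddCommMonoid M] (k : ℕ) (g : ℕ → M) :
    ∑ j ∈ range k, g ((j + 1) % k) = ∑ j ∈ range k, g j := by
  cases k with
  | zero => simp
  | succ n =>
    rw [sum_range_succ, sum_range_succ' g n, Nat.mod_self]
    congr 1
    refine sum_congr rfl fun j hj => ?_
    rw [Nat.mod_eq_of_lt (by simpa using hj)]

open Classical in
/-- The circulation of value `m` along the closed walk `v 0, …, v (k - 1), v 0`. -/
noncomputable def cycleFlow {V : Type*} (k : ℕ) (v : ℕ → V) (m : ℝ) (x y : V) : ℝ :=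
  ∑ j ∈ range k, if x = v j ∧ y = v ((j + 1) % k) then m else 0

theorem sum_cycleFlow_comm {V : Type*} [Fintype V] (k : ℕ) (v : ℕ → V) (m : ℝ) (x : V) :
    ∑ u, cycleFlow k v m u x = ∑ u, cycleFlow k v m x u := by
  classical
  unfold cycleFlow
  rw [sum_comm, sum_comm (s := univ)]
  simp only [ite_and, sum_ite_eq', mem_univ, if_true]
  have h := sum_range_succ_mod k fun j => if x = v j then m else 0
  rw [h]
  refine sum_congr rfl fun j _ => ?_
  split_ifs <;> simp

theorem cycleFlow_edge {V : Type*} {k : ℕ} {v : ℕ → V} (m : ℝ)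
    (hinj : ∀ i < k, ∀ j < k, v i = v j → i = j) {j : ℕ} (hj : j < k) :
    cycleFlow k v m (v j) (v ((j + 1) % k)) = m := by
  classical
  unfold cycleFlow
  rw [sum_eq_single_of_mem j (mem_range.2 hj)]
  · simp
  · intro i hi hij
    exact if_neg fun h => hij (hinj i (mem_range.1 hi) j hj h.1.symm)

theorem cycleFlow_of_not_edge {V : Type*} {k : ℕ} {v : ℕ → V} (m : ℝ) {x y : V}
    (h : ∀ j < k, ¬(x = v j ∧ y = v ((j + 1) % k))) : cycleFlow k v m x y = 0 :=
  sum_eq_zero fun j hj => if_neg (h j (mem_range.1 hj))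

theorem eq_sub_cycleFlow {V : Type*} {k : ℕ} {v : ℕ → V} {m : ℝ}
    (hinj : ∀ i < k, ∀ j < k, v i = v j → i = j) {g g' : V → V → ℝ}
    (hc : ∀ j < k, g' (v j) (v ((j + 1) % k)) = g (v j) (v ((j + 1) % k)) - m)
    (ho : ∀ x y, (∀ j < k, ¬(x = v j ∧ y = v ((j + 1) % k))) → g' x y = g x y) (x y : V) :
    g' x y = g x y - cycleFlow k v m x y := by
  by_cases h : ∀ j < k, ¬(x = v j ∧ y = v ((j + 1) % k))
  · rw [ho x y h, cycleFlow_of_not_edge m h, sub_zero]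
  · push Not at h
    obtain ⟨j, hj, rfl, rfl⟩ := h
    rw [hc j hj, cycleFlow_edge m hinj hj]

theorem stmt2 {V : Type*} [Fintype V]
    (s t : V) (hst : s ≠ t) (B : V → V → ℝ) (C : V → ℝ)
    (hB : ∀ u v, 0 ≤ B u v) (hC : ∀ v, 0 ≤ C v)
    (f w : V → V → ℝ) (p : V → ℝ)
    (hsol : IsPFS s t B C f w p)
    -- a cycle `v 0, v 1, …, v (k-1)` of pairwise distinct vertices (`k ≥ 2`)
    (k : ℕ) (hk : 2 ≤ k) (v : ℕ → V)
    (hinj : ∀ i < k, ∀ j < k, v i = v j → i = j)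
    -- every cycle edge carries positive unprocessed flow `w`
    (hpos : ∀ j < k, 0 < w (v j) (v ((j + 1) % k)))
    -- `m` is the minimum of `w` over the cycle edges
    (m : ℝ)
    (hm₁ : ∀ j < k, m ≤ w (v j) (v ((j + 1) % k)))
    (hm₂ : ∃ j < k, m = w (v j) (v ((j + 1) % k)))
    -- `f'` and `w'` subtract `m` from `f` and `w` on each cycle edge
    (f' w' : V → V → ℝ)
    (hf'c : ∀ j < k, f' (v j) (v ((j + 1) % k)) = f (v j) (v ((j + 1) % k)) - m)
    (hw'c : ∀ j < k, w' (v j) (v ((j + 1) % k)) = w (v j) (v ((j + 1) % k)) - m)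
    -- and leave `f` and `w` unchanged on all other ordered pairs
    (hf'o : ∀ u u', (∀ j < k, ¬(u = v j ∧ u' = v ((j + 1) % k))) → f' u u' = f u u')
    (hw'o : ∀ u u', (∀ j < k, ¬(u = v j ∧ u' = v ((j + 1) % k))) → w' u u' = w u u') :
    IsPFS s t B C f' w' p ∧
      (∑ u, f' s u - ∑ u, f' u s = ∑ u, f s u - ∑ u, f u s) := by
  have hm : 0 ≤ m := by
    obtain ⟨j, hj, rfl⟩ := hm₂
    exact (hpos j hj).le
  obtain ⟨hcap, hcons, hproc, hp, hsrc, hsink⟩ := hsol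
  have hf' := eq_sub_cycleFlow hinj hf'c hf'o
  have hw' := eq_sub_cycleFlow hinj hw'c hw'o
  have hd_nonneg : ∀ x y, 0 ≤ cycleFlow k v m x y := fun x y =>
    sum_nonneg fun j _ => by split_ifs <;> simp [hm]
  have hd_le : ∀ x y, cycleFlow k v m x y ≤ w x y := by
    intro x y
    by_cases h : ∀ j < k, ¬(x = v j ∧ y = v ((j + 1) % k))
    · rw [cycleFlow_of_not_edge m h]
      exact (hcap x y).1
    · push Not at h
      obtain ⟨j, hj, rfl, rfl⟩ := h
      rw [cycleFlow_edge m hinj hj]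
      exact hm₁ j hj
  have hcirc := sum_cycleFlow_comm k v m
  refine ⟨⟨fun x y => ?_, fun x hxs hxt => ?_, fun x hxs => ?_, hp, fun y => ?_, fun x => ?_⟩, ?_⟩
  · have h := hcap x y
    rw [hf', hw']
    refine ⟨?_, ?_, ?_⟩ <;> linarith [hd_nonneg x y, hd_le x y]
  · simp only [hf', sum_sub_distrib, hcons x hxs hxt, hcirc]
  · simp only [hw', sum_sub_distrib, hproc x hxs, hcirc]
    ring
  · rw [hf', hw', hsrc]
  · rw [hw']
    linarith [hd_nonneg x t, hd_le x t, hsink x]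
  · simp only [hf', sum_sub_distrib, hcirc]
    ring
end

section
/- Let (f, w, p) be a processed-flow solution with f(t,u) = 0 for every u ∈ V, and suppose there is no cyclic sequence of pairwise distinct vertices v_0, …, v_{k−1} (k ≥ 2) with w(v_j, v_{j+1 mod k}) > 0 for all j. Then for every vertex v ∉ {s,t} with p(v) > 0, there exists a walk from s to v with pairwise distinct entries such that every edge (x,y) of the walk satisfies w(x,y) > 0. -/
open Finset

/-- Reachability along a relation is witnessed by a chain without repeated entries. -/
theorem exists_nodup_isChain_of_reflTransGen {α : Type*} {r : α → α → Prop} {a b : α}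
    (h : Relation.ReflTransGen r a b) :
    ∃ l : List α, (a :: l).Nodup ∧ (a :: l).IsChain r ∧ (a :: l).getLast? = some b := by
  induction h using Relation.ReflTransGen.head_induction_on with
  | refl => exact ⟨[], by simp⟩
  | @head u v huv _ ih =>
    obtain ⟨l, hnd, hch, hlast⟩ := ih
    by_cases hu : u ∈ v :: l
    · obtain ⟨l₁, l₂, hl⟩ := List.append_of_mem hu
      rw [hl] at hnd hch hlast
      refine ⟨l₂, hnd.of_append_right, hch.right_of_append, ?_⟩
      rwa [List.getLast?_append_of_ne_nil _ (by simp)] at hlast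
    · exact ⟨v :: l, List.nodup_cons.2 ⟨hu, hnd⟩, List.isChain_cons_cons.2 ⟨huv, hch⟩,
        by rwa [List.getLast?_cons_cons]⟩

theorem List.IsChain.forall_mem_zip_tail {α : Type*} {r : α → α → Prop} {l : List α}
    (h : l.IsChain r) : ∀ e ∈ l.zip l.tail, r e.1 e.2 := by
  induction l with
  | nil => simp
  | cons a l ih =>
    cases l with
    | nil => simp
    | cons b l =>
      rw [List.isChain_cons_cons] at h
      intro e he
      rw [List.tail_cons, List.zip_cons_cons, List.mem_cons] at he
      rcases he with rfl | he
      · exact h.1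
      · exact ih h.2 e he

/-- A vertex set that no edge of positive weight enters has nonpositive net inflow. -/
theorem sum_netInflow_nonpos {V : Type*} [Fintype V] {w : V → V → ℝ} (hw : ∀ u v, 0 ≤ w u v)
    (S : Finset V) (hS : ∀ u v, 0 < w u v → v ∈ S → u ∈ S) :
    ∑ v ∈ S, (∑ u, w u v - ∑ u, w v u) ≤ 0 := by
  have hin : ∑ v ∈ S, ∑ u, w u v = ∑ v ∈ S, ∑ u ∈ S, w u v := by
    refine Finset.sum_congr rfl fun v hv => (Finset.sum_subset (Finset.subset_univ S) ?_).symm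
    intro u _ hu
    exact le_antisymm (not_lt.1 fun h => hu (hS u v h hv)) (hw u v)
  rw [Finset.sum_sub_distrib, hin, Finset.sum_comm, sub_nonpos]
  exact Finset.sum_le_sum fun v _ =>
    Finset.sum_le_sum_of_subset_of_nonneg (Finset.subset_univ S) fun u _ _ => hw v u

/-- Every vertex that processes a positive amount is reachable from the source along edges
carrying unprocessed flow. -/
theorem IsPFS.reflTransGen_source {V : Type*} [Fintype V] {s t : V} {B : V → V → ℝ} {C : V → ℝ}
    {f w : V → V → ℝ} {p : V → ℝ} (h : IsPFS s t B C f w p) {x : V} (hx : 0 < p x) :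
    Relation.ReflTransGen (fun u v => 0 < w u v) s x := by
  classical
  obtain ⟨hw, -, hp, hpC, -, -⟩ := h
  by_contra hs
  let S : Finset V := {v | Relation.ReflTransGen (fun u v => 0 < w u v) v x}
  have hmem (v : V) : v ∈ S ↔ Relation.ReflTransGen (fun u v => 0 < w u v) v x := by simp [S]
  have hle := sum_netInflow_nonpos (fun u v => (hw u v).1) S fun u v huv hv =>
    (hmem u).2 (((hmem v).1 hv).head huv)
  have hsum : ∑ v ∈ S, p v = ∑ v ∈ S, (∑ u, w u v - ∑ u, w v u) :=
    Finset.sum_congr rfl fun v hv => hp v (by rintro rfl; exact hs ((hmem _).1 hv))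
  have hpos : 0 < ∑ v ∈ S, p v :=
    Finset.sum_pos' (fun v _ => (hpC v).1) ⟨x, (hmem x).2 .refl, hx⟩
  linarith

theorem stmt4 {V : Type*} [Fintype V]
    (s t : V) (hst : s ≠ t) (B : V → V → ℝ) (C : V → ℝ)
    (hB : ∀ u v, 0 ≤ B u v) (hC : ∀ v, 0 ≤ C v)
    (f w : V → V → ℝ) (p : V → ℝ)
    (hsol : IsPFS s t B C f w p)
    (houtt : ∀ u, f t u = 0)
    -- there is no cyclic sequence of pairwise distinct vertices with `w > 0` on each edge
    (hnocyc : ¬ ∃ (k : ℕ) (v : ℕ → V), 2 ≤ k ∧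
      (∀ i < k, ∀ j < k, v i = v j → i = j) ∧
      (∀ j < k, 0 < w (v j) (v ((j + 1) % k)))) :
    ∀ x, x ≠ s → x ≠ t → 0 < p x →
      ∃ π : List V, 2 ≤ π.length ∧ π.head? = some s ∧ π.getLast? = some x ∧
        π.Nodup ∧ ∀ e ∈ π.zip π.tail, 0 < w e.1 e.2 := by
  intro x hxs _ hx
  obtain ⟨l, hnd, hch, hlast⟩ :=
    exists_nodup_isChain_of_reflTransGen (hsol.reflTransGen_source hx)
  refine ⟨s :: l, ?_, rfl, hlast, hnd, hch.forall_mem_zip_tail⟩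
  cases l with
  | nil => exact absurd (by simpa using hlast) hxs.symm
  | cons a l => simp
end

section
/- Let I be a nonempty finite index set, and for each i ∈ I let π_i be a walk and let p_i^v ≥ 0 be a nonnegative real for each entry v of π_i; set p_i := Σ_{v entry of π_i} p_i^v. Let B : V × V → ℝ and C : V → ℝ be strictly positive, and let ŵ : V × V → ℝ and q : V → ℝ be nonnegative weights. Suppose the family respects capacities: for every (x,y) ∈ V × V, Σ_{i ∈ I} p_i · (number of occurrences of (x,y) as an edge of π_i) ≤ B(x,y), and for every v ∈ V, Σ_{i ∈ I} (sum of p_i^v over occurrences of v in π_i) ≤ C(v). If A := Σ_{i ∈ I} p_i > 0, then there exists i ∈ I with p_i > 0 such that Σ_{(x,y) edge of π_i} ŵ(x,y)/B(x,y) + min_{v entry of π_i} q(v)/C(v) ≤ ( Σ_{(x,y) ∈ V × V} ŵ(x,y) + Σ_{v ∈ V} q(v) ) / A. -/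
open Finset

theorem List.sum_map_eq_sum_count_mul {α : Type*} [Fintype α] [BEq α] [LawfulBEq α]
    (l : List α) (f : α → ℝ) : (l.map f).sum = ∑ a, (l.count a : ℝ) * f a := by
  classical
  induction l with
  | nil => simp
  | cons b l ih =>
    simp only [List.map_cons, List.sum_cons, ih, List.count_cons, Nat.cast_add, add_mul,
      Finset.sum_add_distrib, beq_iff_eq, Nat.cast_ite, Nat.cast_one, Nat.cast_zero, ite_mul,
      one_mul, zero_mul, Finset.sum_ite_eq, Finset.mem_univ, if_true]
    ring

/-- If every total load `∑ i, m i e` is at most the capacity `b e`, then the loads cost at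
most `∑ e, w e` when a unit of load on `e` costs `w e / b e`. -/
theorem sum_mul_sum_div_le {ι α : Type*} [Fintype ι] [Fintype α] (m : ι → α → ℝ)
    (b w : α → ℝ) (hb : ∀ e, 0 < b e) (hw : ∀ e, 0 ≤ w e) (hcap : ∀ e, ∑ i, m i e ≤ b e) :
    ∑ i, ∑ e, m i e * (w e / b e) ≤ ∑ e, w e := by
  rw [Finset.sum_comm]
  refine Finset.sum_le_sum fun e _ => ?_
  rw [← Finset.sum_mul]
  calc (∑ i, m i e) * (w e / b e) ≤ b e * (w e / b e) :=
        mul_le_mul_of_nonneg_right (hcap e) (div_nonneg (hw e) (hb e).le)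
    _ = w e := mul_div_cancel₀ _ (hb e).ne'

/-- A weighted average attains, at some positive weight, a value at most the average. -/
theorem exists_pos_le_div_of_sum_mul_le {ι : Type*} [Fintype ι] (p X : ι → ℝ) (S : ℝ)
    (hp : ∀ i, 0 ≤ p i) (hA : 0 < ∑ i, p i) (h : ∑ i, p i * X i ≤ S) :
    ∃ i, 0 < p i ∧ X i ≤ S / ∑ i, p i := by
  by_contra! hcon
  obtain ⟨k, hk, hpk⟩ : ∃ k ∈ Finset.univ, 0 < p k :=
    Finset.exists_lt_of_sum_lt (f := fun _ => (0 : ℝ)) (by simpa using hA)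
  have hlt : ∑ i, p i * (S / ∑ i, p i) < ∑ i, p i * X i := by
    refine Finset.sum_lt_sum (fun i _ => ?_)
      ⟨k, hk, mul_lt_mul_of_pos_left (hcon k hpk) hpk⟩
    rcases (hp i).eq_or_lt with h0 | h0
    · simp [← h0]
    · exact mul_le_mul_of_nonneg_left (hcon i h0).le h0.le
  rw [← Finset.sum_mul, mul_div_cancel₀ _ hA.ne'] at hlt
  exact absurd h hlt.not_ge

theorem stmt8 {V : Type*} [Fintype V] [DecidableEq V]
    {ι : Type*} [Fintype ι] [Nonempty ι]
    -- for each `i`, a walk `π i` (a list of at least two vertices)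
    (π : ι → List V) (hπ : ∀ i, 2 ≤ (π i).length)
    -- a nonnegative real `pv i j` for each entry (position `j`) of the walk `π i`
    (pv : (i : ι) → Fin (π i).length → ℝ) (hpv : ∀ i j, 0 ≤ pv i j)
    (B : V → V → ℝ) (hB : ∀ u v, 0 < B u v)
    (C : V → ℝ) (hC : ∀ v, 0 < C v)
    (what : V → V → ℝ) (hwhat : ∀ u v, 0 ≤ what u v)
    (q : V → ℝ) (hq : ∀ v, 0 ≤ q v)
    -- the family respects edge capacities
    (hcapB : ∀ x y,
      ∑ i, (∑ j, pv i j) * (((π i).zip (π i).tail).count (x, y) : ℝ) ≤ B x y)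
    -- and vertex processing capacities
    (hcapC : ∀ x,
      ∑ i, ∑ j ∈ univ.filter (fun j : Fin (π i).length => (π i).get j = x), pv i j
        ≤ C x)
    (hA : 0 < ∑ i, ∑ j, pv i j) :
    ∃ i, 0 < ∑ j, pv i j ∧
      (((π i).zip (π i).tail).map (fun e => what e.1 e.2 / B e.1 e.2)).sum
        + Finset.univ.inf' ⟨⟨0, by have := hπ i; omega⟩, Finset.mem_univ _⟩
            (fun j : Fin (π i).length => q ((π i).get j) / C ((π i).get j))
      ≤ ((∑ x, ∑ y, what x y) + ∑ v, q v) / (∑ i, ∑ j, pv i j) := by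
  refine exists_pos_le_div_of_sum_mul_le (fun i => ∑ j, pv i j) _ _
    (fun i => Finset.sum_nonneg fun j _ => hpv i j) hA ?_
  simp only [mul_add, Finset.sum_add_distrib]
  refine add_le_add ?_ ?_
  · simp only [List.sum_map_eq_sum_count_mul, Finset.mul_sum, ← mul_assoc]
    rw [← Fintype.sum_prod_type' what]
    exact sum_mul_sum_div_le
      (fun i e => (∑ j, pv i j) * (((π i).zip (π i).tail).count e : ℝ))
      (fun e => B e.1 e.2) (fun e => what e.1 e.2) (fun e => hB e.1 e.2)
      (fun e => hwhat e.1 e.2) (fun e => hcapB e.1 e.2)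
  · refine le_trans (Finset.sum_le_sum fun i _ => ?_) (sum_mul_sum_div_le
      (fun i x => ∑ j ∈ univ.filter (fun j : Fin (π i).length => (π i).get j = x), pv i j)
      C q hC hq hcapC)
    calc _ ≤ ∑ j, pv i j * (q ((π i).get j) / C ((π i).get j)) := by
          rw [Finset.sum_mul]
          exact Finset.sum_le_sum fun j hj =>
            mul_le_mul_of_nonneg_left (Finset.inf'_le _ hj) (hpv i j)
      _ = _ := by
          rw [← Finset.sum_fiberwise univ (π i).get]
          refine Finset.sum_congr rfl fun x _ => ?_
          rw [Finset.sum_mul]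
          refine Finset.sum_congr rfl fun j hj => ?_
          rw [(Finset.mem_filter.mp hj).2]
end

section
/- Let ε and m be real numbers with 0 < ε < 1 and m ≥ 1, and set δ := (1+ε) · ((1+ε)·m)^{−1/ε}. Then the quantity [ (ln(1/(m·δ)))/ε ] divided by [ ln((1+ε)/δ) / ln(1+ε) ] equals (1−ε) · ln(1+ε)/ε, and in particular it is at least (1−ε)·(1−ε/2). -/
theorem stmt10 (ε m : ℝ) (hε : 0 < ε) (hε1 : ε < 1) (hm : 1 ≤ m) :
    (Real.log (1 / (m * ((1 + ε) * ((1 + ε) * m) ^ (-(1 / ε))))) / ε) /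
        (Real.log ((1 + ε) / ((1 + ε) * ((1 + ε) * m) ^ (-(1 / ε)))) / Real.log (1 + ε))
      = (1 - ε) * Real.log (1 + ε) / ε ∧
    (1 - ε) * (1 - ε / 2) ≤
      (Real.log (1 / (m * ((1 + ε) * ((1 + ε) * m) ^ (-(1 / ε))))) / ε) /
        (Real.log ((1 + ε) / ((1 + ε) * ((1 + ε) * m) ^ (-(1 / ε)))) / Real.log (1 + ε)) := by
  have hbase : 0 < (1 + ε) * m := by positivity
  have hL : 0 < Real.log ((1 + ε) * m) := Real.log_pos (by nlinarith)
  have hnum : Real.log (1 / (m * ((1 + ε) * ((1 + ε) * m) ^ (-(1 / ε)))))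
      = (1 / ε - 1) * Real.log ((1 + ε) * m) := by
    rw [one_div, Real.log_inv, ← mul_assoc, mul_comm m,
      Real.log_mul hbase.ne' (Real.rpow_pos_of_pos hbase _).ne', Real.log_rpow hbase]
    ring
  have hden : Real.log ((1 + ε) / ((1 + ε) * ((1 + ε) * m) ^ (-(1 / ε))))
      = 1 / ε * Real.log ((1 + ε) * m) := by
    rw [div_mul_cancel_left₀ (by positivity), Real.log_inv, Real.log_rpow hbase]
    ring
  have hlog : 0 < Real.log (1 + ε) := Real.log_pos (by linarith)
  have hlow : ε * (1 - ε / 2) ≤ Real.log (1 + ε) := by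
    refine le_trans ?_ (Real.le_log_one_add_of_nonneg hε.le)
    rw [le_div_iff₀ (by positivity)]
    nlinarith [pow_pos hε 3]
  rw [hnum, hden]
  have heq : ((1 / ε - 1) * Real.log ((1 + ε) * m) / ε) /
      (1 / ε * Real.log ((1 + ε) * m) / Real.log (1 + ε))
      = (1 - ε) * Real.log (1 + ε) / ε := by
    field_simp
  refine ⟨heq, ?_⟩
  rw [heq, le_div_iff₀ hε, mul_assoc, mul_comm _ ε]
  exact mul_le_mul_of_nonneg_left hlow (by linarith)
end

section
/- Let U be a finite nonempty set, 𝒮 a finite family of subsets of U, and T ⊆ 𝒮. Construct the network with vertex set {s, t} ⊎ 𝒮 ⊎ U (all distinct) and capacities: B(s, S) = |U| for every S ∈ 𝒮; B(S, u) = 1 whenever S ∈ 𝒮 and u ∈ S, and B(S, u) = 0 if u ∉ S; B(u, t) = 1 for every u ∈ U; B = 0 on all other ordered pairs. Processing capacities: C(S) = |U| for S ∈ T, and C = 0 at every other vertex (including all S ∈ 𝒮 ∖ T, all u ∈ U, s, and t). Let N := |{u ∈ U : ∃ S ∈ T, u ∈ S}| be the number of elements of U covered by T. Then there exists a processed-flow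 solution with source s and sink t of value exactly N, and every processed-flow solution with source s and sink t on this network has value at most N. -/
open Finset

/-- The vertex set of the set-cover network: source, sink, one vertex per set
(indexed by `ι`), and one vertex per universe element. -/
abbrev SCVertex (ι U : Type*) := (Unit ⊕ Unit) ⊕ (ι ⊕ U)

/-- Edge capacities of the set-cover network. -/
def scB {ι U : Type*} [Fintype U] [DecidableEq U] (Sets : ι → Finset U) :
    SCVertex ι U → SCVertex ι U → ℝ
  | .inl (.inl _), .inr (.inl _) => (Fintype.card U : ℝ)
  | .inr (.inl i), .inr (.inr u) => if u ∈ Sets i then 1 else 0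
  | .inr (.inr _), .inl (.inr _) => 1
  | _, _ => 0

/-- Vertex processing capacities of the set-cover network: capacity `|U|` at the
purchased set-vertices (those in `T`), and `0` everywhere else. -/
def scC {ι U : Type*} [Fintype U] [DecidableEq ι] (T : Finset ι) :
    SCVertex ι U → ℝ
  | .inr (.inl i) => if i ∈ T then (Fintype.card U : ℝ) else 0
  | _ => 0

/-- Every element covered by `T` can be assigned one unit of weight on the sets of `T`
containing it. -/
theorem exists_cover_assignment {ι U : Type*} [Fintype ι] [DecidableEq ι] [DecidableEq U]
    (Sets : ι → Finset U) (T : Finset ι) :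
    ∃ x : ι → U → ℝ, (∀ i u, 0 ≤ x i u) ∧ (∀ i u, x i u ≤ if u ∈ Sets i then 1 else 0) ∧
      (∀ i u, i ∉ T → x i u = 0) ∧
      ∀ u, ∑ i, x i u = if u ∈ T.biUnion Sets then 1 else 0 := by
  have h : ∀ u, ∃ y : ι → ℝ, (∀ i, 0 ≤ y i) ∧ (∀ i, y i ≤ if u ∈ Sets i then 1 else 0) ∧
      (∀ i, i ∉ T → y i = 0) ∧ ∑ i, y i = if u ∈ T.biUnion Sets then 1 else 0 := by
    intro u
    by_cases hu : u ∈ T.biUnion Sets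
    · obtain ⟨j, hj, huj⟩ := mem_biUnion.mp hu
      refine ⟨fun i => if i = j then 1 else 0, fun i => ?_, fun i => ?_, fun i hi => ?_, ?_⟩
      · positivity
      · by_cases hij : i = j
        · simp [hij, huj]
        · simp only [hij, if_false]
          positivity
      · exact if_neg (ne_of_mem_of_not_mem hj hi).symm
      · rw [if_pos hu]
        simp
    · refine ⟨fun _ => 0, fun _ => le_rfl, fun i => ?_, fun _ _ => rfl, ?_⟩
      · positivity
      · rw [if_neg hu]
        simp
  choose y h0 h1 h2 h3 using h
  exact ⟨fun i u => y u i, fun i u => h0 u i, fun i u => h1 u i, fun i u => h2 u i, h3⟩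

/-- The flow induced on the set-cover network by an amount `x i u` on each edge from a set to an
element. -/
def scFlow {ι U : Type*} [Fintype ι] [Fintype U] (x : ι → U → ℝ) :
    SCVertex ι U → SCVertex ι U → ℝ
  | .inl (.inl _), .inr (.inl i) => ∑ u, x i u
  | .inr (.inl i), .inr (.inr u) => x i u
  | .inr (.inr u), .inl (.inr _) => ∑ i, x i u
  | _, _ => 0

/-- The unprocessed part of `scFlow x`, when all processing happens at set-vertices. -/
def scRawFlow {ι U : Type*} [Fintype U] (x : ι → U → ℝ) :
    SCVertex ι U → SCVertex ι U → ℝ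
  | .inl (.inl _), .inr (.inl i) => ∑ u, x i u
  | _, _ => 0

/-- The amount of processing of `scFlow x` at each vertex. -/
def scLoad {ι U : Type*} [Fintype U] (x : ι → U → ℝ) : SCVertex ι U → ℝ
  | .inr (.inl i) => ∑ u, x i u
  | _ => 0

theorem isPFS_scFlow {ι U : Type*} [Fintype ι] [DecidableEq ι] [Fintype U] [DecidableEq U]
    (Sets : ι → Finset U) (T : Finset ι) (x : ι → U → ℝ) (h0 : ∀ i u, 0 ≤ x i u)
    (hS : ∀ i u, x i u ≤ if u ∈ Sets i then 1 else 0) (hT : ∀ i u, i ∉ T → x i u = 0)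
    (h1 : ∀ u, ∑ i, x i u ≤ 1) :
    IsPFS (Sum.inl (Sum.inl ())) (Sum.inl (Sum.inr ())) (scB Sets) (scC T)
      (scFlow x) (scRawFlow x) (scLoad x) := by
  have hU : ∀ i, ∑ u, x i u ≤ (Fintype.card U : ℝ) := fun i => by
    calc ∑ u, x i u ≤ ∑ _u : U, (1 : ℝ) :=
          sum_le_sum fun u _ => (hS i u).trans (by split_ifs <;> norm_num)
      _ = Fintype.card U := by simp
  have hs : ∀ i, 0 ≤ ∑ u, x i u := fun i => sum_nonneg fun u _ => h0 i u
  have he : ∀ u, 0 ≤ ∑ i, x i u := fun u => sum_nonneg fun i _ => h0 i u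
  refine ⟨?_, ?_, ?_, ?_, ?_, ?_⟩
  · rintro ((_ | _) | (i | u)) ((_ | _) | (j | v)) <;>
      simp [scFlow, scRawFlow, scB, h0, hs, he, h1, hU, hS]
  · rintro ((_ | _) | (i | u)) <;> simp [scFlow]
  · rintro ((_ | _) | (i | u)) <;> simp [scRawFlow, scLoad]
  · rintro ((_ | _) | (i | u)) <;> simp only [scLoad, scC, le_refl, and_self]
    refine ⟨hs i, ?_⟩
    split_ifs with hi
    · exact hU i
    · exact (sum_eq_zero fun u _ => hT i u hi).le
  · rintro ((_ | _) | (i | u)) <;> rfl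
  · rintro ((_ | _) | (i | u)) <;> rfl

theorem IsPFS.value_le_card_biUnion {ι U : Type*} [Fintype ι] [DecidableEq ι] [Fintype U]
    [DecidableEq U] {Sets : ι → Finset U} {T : Finset ι}
    {f w : SCVertex ι U → SCVertex ι U → ℝ} {p : SCVertex ι U → ℝ}
    (h : IsPFS (Sum.inl (Sum.inl ())) (Sum.inl (Sum.inr ())) (scB Sets) (scC T) f w p) :
    ∑ u, f (Sum.inl (Sum.inl ())) u ≤ ((T.biUnion Sets).card : ℝ) := by
  obtain ⟨hcap, hcons, hproc, hC, hws, hwt⟩ := h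
  have hf0 : ∀ a b, 0 ≤ f a b := fun a b => (hcap a b).1.trans (hcap a b).2.1
  have hfz : ∀ a b, scB Sets a b = 0 → f a b = 0 := fun a b hab =>
    le_antisymm (hab ▸ (hcap a b).2.2) (hf0 a b)
  have hwz : ∀ a b, scB Sets a b = 0 → w a b = 0 := fun a b hab =>
    le_antisymm (hfz a b hab ▸ (hcap a b).2.1) (hcap a b).1
  have hw_elem : ∀ i u, w (.inr (.inl i)) (.inr (.inr u)) = 0 := by
    intro i u
    have hout : ∑ b, w (.inr (.inr u)) b = 0 := by
      refine sum_eq_zero fun b _ => ?_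
      rcases b with (_ | _) | (_ | _)
      · exact hwz _ _ rfl
      · exact hwt _
      · exact hwz _ _ rfl
      · exact hwz _ _ rfl
    have hin : ∑ a, w a (.inr (.inr u)) = 0 := by
      have h1 := hproc (.inr (.inr u)) (by simp)
      have h2 : p (.inr (.inr u)) = 0 :=
        le_antisymm (hC (.inr (.inr u))).2 (hC (.inr (.inr u))).1
      linarith
    exact (sum_eq_zero_iff_of_nonneg fun a _ => (hcap a _).1).mp hin _ (mem_univ _)
  have hsource : ∀ i, i ∉ T → f (.inl (.inl ())) (.inr (.inl i)) = 0 := by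
    intro i hi
    have h1 := hproc (.inr (.inl i)) (by simp)
    have h2 : p (.inr (.inl i)) ≤ 0 := by simpa [scC, hi] using (hC (.inr (.inl i))).2
    have hout : ∑ b, w (.inr (.inl i)) b = 0 := by
      refine sum_eq_zero fun b _ => ?_
      rcases b with (_ | _) | (_ | u)
      · exact hwz _ _ rfl
      · exact hwz _ _ rfl
      · exact hwz _ _ rfl
      · exact hw_elem i u
    have hle := single_le_sum (f := fun a => w a (.inr (.inl i))) (fun a _ => (hcap a _).1)
      (mem_univ (.inl (.inl ())))
    have hf := hf0 (.inl (.inl ())) (.inr (.inl i))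
    have hw := hws (.inr (.inl i))
    linarith
  have hset : ∀ i, f (.inl (.inl ())) (.inr (.inl i)) =
      ∑ u, f (.inr (.inl i)) (.inr (.inr u)) := by
    intro i
    have h1 := hcons (.inr (.inl i)) (by simp) (by simp)
    simpa [hfz (.inl (.inr ())) (.inr (.inl i)) rfl, hfz (.inr (.inl i)) (.inl (.inl ())) rfl,
      hfz (.inr (.inl i)) (.inl (.inr ())) rfl,
      fun j j' => hfz (.inr (.inl j)) (.inr (.inl j')) rfl,
      fun u => hfz (.inr (.inr u)) (.inr (.inl i)) rfl] using h1
  have helem : ∀ u, ∑ i, f (.inr (.inl i)) (.inr (.inr u)) ≤ 1 := by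
    intro u
    have h1 := hcons (.inr (.inr u)) (by simp) (by simp)
    have h2 : ∑ i, f (.inr (.inl i)) (.inr (.inr u)) = f (.inr (.inr u)) (.inl (.inr ())) := by
      simpa [hfz (.inl (.inl ())) (.inr (.inr u)) rfl, hfz (.inl (.inr ())) (.inr (.inr u)) rfl,
        fun v => hfz (.inr (.inr v)) (.inr (.inr u)) rfl,
        hfz (.inr (.inr u)) (.inl (.inl ())) rfl, fun i => hfz (.inr (.inr u)) (.inr (.inl i)) rfl,
        fun v => hfz (.inr (.inr u)) (.inr (.inr v)) rfl] using h1
    exact h2 ▸ (hcap _ _).2.2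
  calc ∑ b, f (.inl (.inl ())) b = ∑ i, f (.inl (.inl ())) (.inr (.inl i)) := by
        simp [hfz (.inl (.inl ())) (.inl (.inl ())) rfl, hfz (.inl (.inl ())) (.inl (.inr ())) rfl,
          fun u => hfz (.inl (.inl ())) (.inr (.inr u)) rfl]
    _ = ∑ i ∈ T, f (.inl (.inl ())) (.inr (.inl i)) :=
        (sum_subset (subset_univ T) fun i _ hi => hsource i hi).symm
    _ = ∑ u, ∑ i ∈ T, f (.inr (.inl i)) (.inr (.inr u)) := by
        rw [sum_congr rfl fun i _ => hset i, sum_comm]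
    _ ≤ ∑ u, if u ∈ T.biUnion Sets then 1 else 0 := by
        refine sum_le_sum fun u _ => ?_
        split_ifs with hu
        · exact (sum_le_sum_of_subset_of_nonneg (subset_univ T) fun i _ _ => hf0 _ _).trans
            (helem u)
        · refine (sum_eq_zero fun i hi => hfz _ _ ?_).le
          exact if_neg fun hui => hu (mem_biUnion.mpr ⟨i, hi, hui⟩)
    _ = ((T.biUnion Sets).card : ℝ) := by simp [-mem_biUnion]

theorem stmt11 {ι U : Type*} [Fintype ι] [DecidableEq ι] [Fintype U] [DecidableEq U]
    [Nonempty U] (Sets : ι → Finset U) (T : Finset ι) :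
    (∃ (f w : SCVertex ι U → SCVertex ι U → ℝ) (p : SCVertex ι U → ℝ),
        IsPFS (Sum.inl (Sum.inl ())) (Sum.inl (Sum.inr ())) (scB Sets) (scC T) f w p ∧
        ∑ u, f (Sum.inl (Sum.inl ())) u = ((T.biUnion Sets).card : ℝ)) ∧
    (∀ (f w : SCVertex ι U → SCVertex ι U → ℝ) (p : SCVertex ι U → ℝ),
        IsPFS (Sum.inl (Sum.inl ())) (Sum.inl (Sum.inr ())) (scB Sets) (scC T) f w p →
        ∑ u, f (Sum.inl (Sum.inl ())) u ≤ ((T.biUnion Sets).card : ℝ)) := by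
  refine ⟨?_, fun f w p h => h.value_le_card_biUnion⟩
  obtain ⟨x, h0, hS, hT, h1⟩ := exists_cover_assignment Sets T
  refine ⟨scFlow x, scRawFlow x, scLoad x, isPFS_scFlow Sets T x h0 hS hT fun u => ?_, ?_⟩
  · rw [h1]
    split_ifs <;> norm_num
  · calc ∑ b, scFlow x (Sum.inl (Sum.inl ())) b = ∑ i, ∑ u, x i u := by simp [scFlow]
      _ = ∑ u, ∑ i, x i u := sum_comm
      _ = ((T.biUnion Sets).card : ℝ) := by simp [h1, -mem_biUnion]
end

section
/- Let G be a finite simple undirected graph with vertex set V, |V| = n, and let T ⊆ V. Consider the following instance: the network is G with capacity 2 on every edge; for every ordered pair (u,v) of vertices with {u,v} an edge of G there is one commodity demanding 1 unit of processed flow from u to v; the processing capacity of a vertex x is 2n if x ∈ T and 0 otherwise. A walk-based multicommodity solution assigns to each commodity (u,v) nonnegative reals a_{(u,v)}(π, x) over pairs (π, x), where π is a walk in G from u to v and x is an entry of π. It satisfies all demands if Σ_{(π,x)} a_{(u,v)}(π,x) = 1 for every commodity (u,v); it respects capacities if for every edge {x,y} of G, the sum over all commodities and all pairs (π, z) of a·(number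 of traversals of {x,y} by π, in either direction) is at most 2, and for every vertex x, the sum over all commodities and all walks π of a(π, x) is at most the processing capacity of x. Then a walk-based multicommodity solution satisfying all demands and respecting capacities exists if and only if T is a vertex cover of G, i.e., every edge of G has at least one endpoint in T. -/
open Finset

theorem List.IsChain.rel_of_mem_zip_tail {α : Type*} {R : α → α → Prop} {l : List α}
    (h : l.IsChain R) {p : α × α} (hp : p ∈ l.zip l.tail) : R p.1 p.2 := by
  induction l with
  | nil => simp at hp
  | cons a l ih =>
    cases l with
    | nil => simp at hp
    | cons b l =>
      rw [List.isChain_cons_cons] at h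
      simp only [List.tail_cons, List.zip_cons_cons, List.mem_cons] at hp
      rcases hp with rfl | hp
      · exact h.1
      · exact ih h.2 (by simpa using hp)

theorem List.IsChain.sum_count_zip_tail {V : Type*} [Fintype V] [DecidableEq V]
    {G : SimpleGraph V} [DecidableRel G.Adj] {l : List V} (h : l.IsChain G.Adj) :
    ∑ p ∈ univ.filter (fun p : V × V => G.Adj p.1 p.2), (l.zip l.tail).count p
      = l.length - 1 := by
  have := Multiset.sum_count_eq_card (s := univ.filter (fun p : V × V => G.Adj p.1 p.2))
    (m := (l.zip l.tail : Multiset (V × V)))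
    (fun p hp => by simpa using h.rel_of_mem_zip_tail (by simpa using hp))
  simp only [Multiset.coe_count, Multiset.coe_card, List.length_zip, List.length_tail] at this
  convert this using 1
  · refine Finset.sum_congr rfl fun p _ => ?_
    congr 1
    exact lawful_beq_subsingleton _ _
  · omega

theorem SimpleGraph.sum_swap_adj {V M : Type*} [Fintype V] [AddCommMonoid M]
    (G : SimpleGraph V) [DecidableRel G.Adj] (f : V × V → M) :
    ∑ p ∈ univ.filter (fun p : V × V => G.Adj p.1 p.2), f p.swap
      = ∑ p ∈ univ.filter (fun p : V × V => G.Adj p.1 p.2), f p := by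
  refine Finset.sum_equiv (Equiv.prodComm V V) ?_ ?_
  · simp [G.adj_comm]
  · simp

theorem stmt12 {V : Type*} [Fintype V] [DecidableEq V]
    (G : SimpleGraph V) [DecidableRel G.Adj] (T : Finset V) :
    -- there is a walk-based multicommodity solution satisfying all demands and
    -- respecting capacities, encoded as finitely many weighted (commodity, walk,
    -- processing-vertex) triples ...
    (∃ (k : ℕ) (com : Fin k → V × V) (wk : Fin k → List V)
        (proc : Fin k → V) (amt : Fin k → ℝ),
      -- each triple is valid: the commodity is an ordered adjacent pair, the walk is a
      -- walk in `G` from the source to the sink of its commodity, the processing vertex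
      -- is an entry of the walk, and the amount is nonnegative
      (∀ i, G.Adj (com i).1 (com i).2 ∧ 2 ≤ (wk i).length ∧
        (wk i).Chain' G.Adj ∧ (wk i).head? = some (com i).1 ∧
        (wk i).getLast? = some (com i).2 ∧ proc i ∈ wk i ∧ 0 ≤ amt i) ∧
      -- all demands are satisfied: each commodity routes exactly 1 unit
      (∀ u v, G.Adj u v →
        ∑ i ∈ univ.filter (fun i => com i = (u, v)), amt i = 1) ∧
      -- edge capacities: for every edge of `G`, the total traversal load in either
      -- direction (with multiplicity) is at most 2
      (∀ x y, G.Adj x y →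
        ∑ i, amt i * ((((wk i).zip (wk i).tail).count (x, y) : ℝ) +
          (((wk i).zip (wk i).tail).count (y, x) : ℝ)) ≤ 2) ∧
      -- vertex capacities: total processing at `x` is at most `2n` if `x ∈ T`, else `0`
      (∀ x, ∑ i ∈ univ.filter (fun i => proc i = x), amt i ≤
        (if x ∈ T then 2 * (Fintype.card V : ℝ) else 0)))
    -- ... if and only if `T` is a vertex cover of `G`
    ↔ (∀ u v, G.Adj u v → u ∈ T ∨ v ∈ T) := by
  classical
  set D := univ.filter (fun p : V × V => G.Adj p.1 p.2) with hD
  constructor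
  · rintro ⟨k, com, wk, proc, amt, hval, hdem, hedge, hvert⟩
    have htotal : ∑ i, amt i = #D := by
      rw [← Finset.sum_fiberwise_of_maps_to (s := univ) (t := D) (g := com)
        (fun i _ => by simpa [hD] using (hval i).1)]
      rw [Finset.sum_congr rfl (g := fun _ => (1 : ℝ))]
      · simp
      · intro p hp
        exact hdem p.1 p.2 (by simpa [hD] using hp)
    have hcount : ∀ i, ∑ p ∈ D, ((((wk i).zip (wk i).tail).count p : ℝ) +
        (((wk i).zip (wk i).tail).count p.swap : ℝ)) = 2 * ((wk i).length - 1) := by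
      intro i
      obtain ⟨-, hlen, hch, -⟩ := hval i
      rw [Finset.sum_add_distrib,
        G.sum_swap_adj (fun p => (((wk i).zip (wk i).tail).count p : ℝ)), ← Nat.cast_sum,
        List.IsChain.sum_count_zip_tail hch, Nat.cast_sub (by omega)]
      push_cast
      ring
    have hload : ∑ i, amt i * (2 * (((wk i).length : ℝ) - 1)) ≤ 2 * #D := by
      simp_rw [← hcount, Finset.mul_sum]
      rw [Finset.sum_comm, mul_comm, ← nsmul_eq_mul]
      exact Finset.sum_le_card_nsmul _ _ _ fun p hp =>
        hedge p.1 p.2 (by simpa [hD] using hp)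
    have hnonneg : ∀ i ∈ univ, 0 ≤ amt i * (((wk i).length : ℝ) - 2) := fun i _ =>
      mul_nonneg (hval i).2.2.2.2.2.2
        (sub_nonneg.2 (by exact_mod_cast (hval i).2.1))
    have hzero : ∑ i, amt i * (((wk i).length : ℝ) - 2) = 0 := by
      refine le_antisymm ?_ (Finset.sum_nonneg hnonneg)
      have : ∑ i, amt i * (((wk i).length : ℝ) - 2)
          = (∑ i, amt i * (2 * (((wk i).length : ℝ) - 1))) / 2 - ∑ i, amt i := by
        rw [Finset.sum_div, ← Finset.sum_sub_distrib]
        exact Finset.sum_congr rfl fun i _ => by ring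
      rw [this, htotal]
      linarith
    rw [Finset.sum_eq_zero_iff_of_nonneg hnonneg] at hzero
    intro u v huv
    obtain ⟨i, hi, hne⟩ : ∃ i ∈ univ.filter (fun i => com i = (u, v)), amt i ≠ 0 :=
      Finset.exists_ne_zero_of_sum_ne_zero (by rw [hdem u v huv]; exact one_ne_zero)
    obtain ⟨-, -, -, hhead, hlast, hproc, hamt⟩ := hval i
    have hcom : com i = (u, v) := by simpa using hi
    have hlen : (wk i).length = 2 := by
      have := (mul_eq_zero.1 (hzero i (mem_univ i))).resolve_left hne
      exact_mod_cast sub_eq_zero.1 this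
    obtain ⟨a, b, hab⟩ := List.length_eq_two.1 hlen
    have hprocT : proc i ∈ T := by
      by_contra hT
      have hle := hvert (proc i)
      rw [if_neg hT] at hle
      have := Finset.single_le_sum (s := univ.filter (fun j => proc j = proc i)) (f := amt)
        (fun j _ => (hval j).2.2.2.2.2.2) (a := i) (by simp)
      exact hne (le_antisymm (this.trans hle) hamt)
    simp only [hab, hcom, List.head?_cons, Option.some.injEq, List.getLast?_cons_cons,
      List.getLast?_singleton, List.mem_cons, List.not_mem_nil, or_false] at hhead hlast hproc
    subst hhead hlast
    rcases hproc with h | h <;> simp [← h, hprocT]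
  · intro hT
    let pr : V × V → V := fun p => if p.1 ∈ T then p.1 else p.2
    let e := D.equivFin.symm
    have hsum : ∀ f : V × V → ℝ, ∑ i, f (e i) = ∑ p ∈ D, f p := fun f => by
      rw [e.sum_comp (fun p => f p), Finset.sum_coe_sort]
    have hadj : ∀ i, G.Adj (e i).1.1 (e i).1.2 := fun i =>
      (Finset.mem_filter.1 (e i).2).2
    refine ⟨#D, fun i => e i, fun i => [(e i).1.1, (e i).1.2], fun i => pr (e i),
      fun _ => 1, fun i => ⟨hadj i, ?_⟩, fun u v huv => ?_, fun x y hxy => ?_, fun x => ?_⟩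
    · have hch : List.IsChain G.Adj [(e i).1.1, (e i).1.2] := by simpa using hadj i
      have hpr : pr (e i) = (e i).1.1 ∨ pr (e i) = (e i).1.2 := by
        dsimp only [pr]
        split_ifs <;> simp
      exact ⟨le_rfl, hch, rfl, rfl, by simpa using hpr, zero_le_one⟩
    · rw [Finset.sum_filter, hsum (fun p => if p = (u, v) then 1 else 0)]
      simp [hD, huv]
    · rw [hsum (fun p => 1 * ((([p.1, p.2].zip [p.1, p.2].tail).count (x, y) : ℝ) +
        (([p.1, p.2].zip [p.1, p.2].tail).count (y, x) : ℝ)))]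
      simp [List.count_singleton, Finset.sum_add_distrib, hD, hxy, hxy.symm, one_add_one_eq_two]
    · rw [Finset.sum_filter, hsum (fun p => if pr p = x then 1 else 0), ← Finset.sum_filter]
      split_ifs with hx
      · have hsub : D.filter (fun p => pr p = x) ⊆ ({x} ×ˢ univ) ∪ (univ ×ˢ {x}) := by
          intro p hp
          have hpx := (Finset.mem_filter.1 hp).2
          dsimp only [pr] at hpx
          split_ifs at hpx <;> simp [Prod.ext_iff, hpx]
        have hcard := (Finset.card_le_card hsub).trans (Finset.card_union_le _ _)
        simp only [Finset.card_product, Finset.card_singleton, Finset.card_univ, one_mul,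
          mul_one] at hcard
        simp only [Finset.sum_const, nsmul_eq_mul, mul_one]
        exact_mod_cast hcard.trans_eq (two_mul _).symm
      · refine (Finset.sum_eq_zero fun p hp => absurd ?_ hx).le
        obtain ⟨hpD, hpx⟩ := Finset.mem_filter.1 hp
        have := hT p.1 p.2 (Finset.mem_filter.1 hpD).2
        rw [← hpx]
        dsimp only [pr]
        split_ifs with h
        · exact h
        · exact this.resolve_left h
end

section
/- Let G be a finite simple 3-regular undirected graph with vertex set I, |I| = n even, and let T ⊆ I with |T| = n/2. Construct the network with vertex set {u_i : i ∈ I} ∪ {w_i : i ∈ I} and undirected edges: {u_i, w_i} with capacity 3 for every i ∈ I, and {u_i, u_j} with capacity 1 for every edge {i,j} of G. For every ordered pair (j, i) ∈ I × I there is a commodity from u_j to w_i with demand 3. The processing capacity of u_i is 3n if i ∈ T and 0 otherwise, and every w_i has processing capacity 0. A walk-based multicommodity solution assigns nonnegative reals a_{(j,i)}(π, x) to pairs (π, x) with π a walk from u_j to w_i and x an entry of π; it is feasible if for every commodity Σ_{(π,x)} a_{(j,i)}(π,x) ≤ 3, for every edge the total traversal load (summed over all commodities, walks, and processing vertices, counting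 traversals in either direction with multiplicity) is at most the edge capacity, and for every vertex the total processing load is at most its processing capacity. Then the maximum over feasible solutions of the total routed flow Σ_{(j,i)} Σ_{(π,x)} a_{(j,i)}(π,x) equals 3n/2 + e_G(T, I∖T), where e_G(T, I∖T) is the number of edges of G with exactly one endpoint in T. -/
open Finset

/-- Adjacency of the network built from `G`: vertex `Sum.inl i` is `u_i` and
`Sum.inr i` is `w_i`; `u_i — w_i` for every `i`, and `u_i — u_j` for every edge
`{i,j}` of `G`. -/
def mbAdj {I : Type*} (G : SimpleGraph I) : (I ⊕ I) → (I ⊕ I) → Prop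
  | .inl i, .inl j => G.Adj i j
  | .inl i, .inr j => i = j
  | .inr i, .inl j => i = j
  | .inr _, .inr _ => False

/-- Edge capacities of the network: 3 on each edge `u_i — w_i`, 1 on each edge
`u_i — u_j` coming from an edge of `G`, and 0 on non-edges. -/
def mbCap {I : Type*} [DecidableEq I] (G : SimpleGraph I) [DecidableRel G.Adj] :
    (I ⊕ I) → (I ⊕ I) → ℝ
  | .inl i, .inl j => if G.Adj i j then 1 else 0
  | .inl i, .inr j => if i = j then 3 else 0
  | .inr i, .inl j => if i = j then 3 else 0
  | .inr _, .inr _ => 0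

/-- Processing capacities: `3n` at `u_i` for `i ∈ T`, zero elsewhere. -/
def mbProcCap {I : Type*} [DecidableEq I] (T : Finset I) (n : ℕ) : (I ⊕ I) → ℝ
  | .inl i => if i ∈ T then 3 * (n : ℝ) else 0
  | .inr _ => 0

/-- The ordered pairs `(j, i)` such that `{j, i}` is an edge of `G` with `j ∈ T` and `i ∉ T`. -/
abbrev cutPairs {I : Type*} [Fintype I] [DecidableEq I] (G : SimpleGraph I) [DecidableRel G.Adj]
    (T : Finset I) : Finset (I × I) :=
  univ.filter fun e => G.Adj e.1 e.2 ∧ e.1 ∈ T ∧ e.2 ∉ T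

/-- A walk that visits some `u_t` with `t ∈ T` and ends at some `w_i` traverses, after its last
visit to such a vertex, an edge `u_j — w_j` with `j ∈ T` or an edge of the cut. -/
lemma exists_traversal_of_mem {I : Type*} [Fintype I] [DecidableEq I] (G : SimpleGraph I)
    [DecidableRel G.Adj] (T : Finset I) (i : I) (l : List (I ⊕ I)) (hl : l.IsChain (mbAdj G))
    (hlast : l.getLast? = some (Sum.inr i)) (hmem : ∃ t ∈ T, Sum.inl t ∈ l) :
    (∃ j ∈ T, (Sum.inl j, Sum.inr j) ∈ l.zip l.tail) ∨
      ∃ p ∈ cutPairs G T, (Sum.inl p.1, Sum.inl p.2) ∈ l.zip l.tail := by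
  induction l with
  | nil => simp at hmem
  | cons x l ih =>
    rcases l with _ | ⟨y, l⟩
    · obtain ⟨t, -, ht⟩ := hmem
      simp at hlast ht
      simp [hlast] at ht
    · rw [List.isChain_cons_cons] at hl
      have hlast' : (y :: l).getLast? = some (Sum.inr i) := by
        rwa [List.getLast?_cons_cons] at hlast
      have hzip : (x :: y :: l).zip (x :: y :: l).tail
          = (x, y) :: (y :: l).zip (y :: l).tail := rfl
      rw [hzip]
      by_cases h : ∃ t ∈ T, Sum.inl t ∈ y :: l
      · rcases ih hl.2 hlast' h with ⟨j, hj, hm⟩ | ⟨p, hp, hm⟩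
        · exact Or.inl ⟨j, hj, List.mem_cons_of_mem _ hm⟩
        · exact Or.inr ⟨p, hp, List.mem_cons_of_mem _ hm⟩
      · obtain ⟨t, ht, hm⟩ := hmem
        have hx : x = Sum.inl t := by
          rcases List.mem_cons.1 hm with hx | hm
          · exact hx.symm
          · exact absurd ⟨t, ht, hm⟩ h
        subst hx
        rcases y with j | j
        · have hj : j ∉ T := fun hj => h ⟨j, hj, by simp⟩
          have hadj : G.Adj t j := hl.1
          exact Or.inr ⟨(t, j), by simp [hadj, ht, hj], by simp⟩
        · have htj : t = j := hl.1
          subst htj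
          exact Or.inl ⟨t, ht, by simp⟩

instance sumLawfulBEq {α β : Type*} [BEq α] [BEq β] [LawfulBEq α] [LawfulBEq β] : LawfulBEq (α ⊕ β) where
  rfl {x} := by
    rcases x with x | x <;> exact beq_self_eq_true x
  eq_of_beq {x y} h := by
    rcases x with x | x <;> rcases y with y | y
    · exact congrArg Sum.inl (eq_of_beq (α := α) h)
    · cases h
    · cases h
    · exact congrArg Sum.inr (eq_of_beq (α := β) h)

/-- The number of traversals, by a walk `l`, of the edge between `x` and `y`. -/
abbrev traversals {I : Type*} [DecidableEq I] (l : List (I ⊕ I)) (x y : I ⊕ I) : ℝ :=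
  ((l.zip l.tail).count (x, y) : ℝ) + ((l.zip l.tail).count (y, x) : ℝ)

lemma traversals_nonneg {I : Type*} [DecidableEq I] (l : List (I ⊕ I)) (x y : I ⊕ I) :
    0 ≤ traversals l x y := by
  positivity

lemma one_le_traversals {I : Type*} [DecidableEq I] {l : List (I ⊕ I)} {x y : I ⊕ I}
    (h : (x, y) ∈ l.zip l.tail) : 1 ≤ traversals l x y := by
  have : (1 : ℝ) ≤ ((l.zip l.tail).count (x, y) : ℝ) := by
    exact_mod_cast List.one_le_count_iff.2 h
  have : (0 : ℝ) ≤ ((l.zip l.tail).count (y, x) : ℝ) := Nat.cast_nonneg _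
  unfold traversals
  linarith

lemma traversals_comm {I : Type*} [DecidableEq I] (l : List (I ⊕ I)) (x y : I ⊕ I) :
    traversals l x y = traversals l y x :=
  add_comm _ _

lemma traversals_inl_inr_inl_inr {I : Type*} [DecidableEq I] (i a b : I) :
    traversals [Sum.inl i, Sum.inr i] (Sum.inl a) (Sum.inr b) =
      if i = a ∧ i = b then 1 else 0 := by
  simp [traversals, List.count_cons]

lemma traversals_inl_inl_inr_inl_inr {I : Type*} [DecidableEq I] (j i a b : I) :
    traversals [Sum.inl j, Sum.inl i, Sum.inr i] (Sum.inl a) (Sum.inr b) =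
      if i = a ∧ i = b then 1 else 0 := by
  simp [traversals, List.count_cons]

lemma traversals_inl_inr_inl_inl {I : Type*} [DecidableEq I] (i a b : I) :
    traversals [Sum.inl i, Sum.inr i] (Sum.inl a) (Sum.inl b) = 0 := by
  simp [traversals]

lemma traversals_inl_inl_inr_inl_inl {I : Type*} [DecidableEq I] (p : I × I) (a b : I) :
    traversals [Sum.inl p.1, Sum.inl p.2, Sum.inr p.2] (Sum.inl a) (Sum.inl b) =
      (if p = (a, b) then 1 else 0) + if p = (b, a) then 1 else 0 := by
  simp [traversals, List.count_cons, Prod.ext_iff]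

lemma one_le_sum_traversals {I : Type*} [Fintype I] [DecidableEq I] (G : SimpleGraph I)
    [DecidableRel G.Adj] (T : Finset I) (i : I) (l : List (I ⊕ I)) (hl : l.IsChain (mbAdj G))
    (hlast : l.getLast? = some (Sum.inr i)) (hmem : ∃ t ∈ T, Sum.inl t ∈ l) :
    1 ≤ ∑ j ∈ T, traversals l (Sum.inl j) (Sum.inr j) +
      ∑ p ∈ cutPairs G T, traversals l (Sum.inl p.1) (Sum.inl p.2) := by
  have h₁ : 0 ≤ ∑ j ∈ T, traversals l (Sum.inl j) (Sum.inr j) :=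
    sum_nonneg fun _ _ => traversals_nonneg _ _ _
  have h₂ : 0 ≤ ∑ p ∈ cutPairs G T, traversals l (Sum.inl p.1) (Sum.inl p.2) :=
    sum_nonneg fun _ _ => traversals_nonneg _ _ _
  rcases exists_traversal_of_mem G T i l hl hlast hmem with ⟨j, hj, hm⟩ | ⟨p, hp, hm⟩
  · have := single_le_sum (f := fun j => traversals l (Sum.inl j) (Sum.inr j))
      (fun _ _ => traversals_nonneg _ _ _) hj
    have := one_le_traversals hm
    linarith
  · have := single_le_sum (f := fun p : I × I => traversals l (Sum.inl p.1) (Sum.inl p.2))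
      (fun _ _ => traversals_nonneg _ _ _) hp
    have := one_le_traversals hm
    linarith

lemma sum_le_of_feasible {I : Type*} [Fintype I] [DecidableEq I] (G : SimpleGraph I)
    [DecidableRel G.Adj] (T : Finset I) {ι : Type*} [Fintype ι] (n : ℕ) (com : ι → I × I)
    (wk : ι → List (I ⊕ I)) (proc : ι → I ⊕ I) (amt : ι → ℝ)
    (hchain : ∀ e, (wk e).IsChain (mbAdj G))
    (hlast : ∀ e, (wk e).getLast? = some (Sum.inr (com e).2))
    (hproc : ∀ e, proc e ∈ wk e) (hamt : ∀ e, 0 ≤ amt e)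
    (hcap : ∀ x y, ∑ e, amt e * traversals (wk e) x y ≤ mbCap G x y)
    (hpcap : ∀ x, ∑ e ∈ univ.filter (fun e => proc e = x), amt e ≤ mbProcCap T n x) :
    ∑ e, amt e ≤ 3 * T.card + (cutPairs G T).card := by
  have hload : ∀ e, amt e ≤
      ∑ j ∈ T, amt e * traversals (wk e) (Sum.inl j) (Sum.inr j) +
        ∑ p ∈ cutPairs G T, amt e * traversals (wk e) (Sum.inl p.1) (Sum.inl p.2) := by
    intro e
    rw [← mul_sum, ← mul_sum, ← mul_add]
    rcases (hamt e).eq_or_lt with h0 | hpos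
    · simp [← h0]
    · refine le_mul_of_one_le_right (hamt e)
        (one_le_sum_traversals G T _ _ (hchain e) (hlast e) ?_)
      have hle : amt e ≤ mbProcCap T n (proc e) :=
        (single_le_sum (f := amt) (fun _ _ => hamt _) (by simp)).trans (hpcap (proc e))
      have hmem := hproc e
      generalize proc e = x at hle hmem
      rcases x with t | t
      · by_cases ht : t ∈ T
        · exact ⟨t, ht, hmem⟩
        · simp only [mbProcCap, ht, if_false] at hle
          linarith
      · simp only [mbProcCap] at hle
        linarith
  calc ∑ e, amt e
      ≤ ∑ e, (∑ j ∈ T, amt e * traversals (wk e) (Sum.inl j) (Sum.inr j) +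
        ∑ p ∈ cutPairs G T, amt e * traversals (wk e) (Sum.inl p.1) (Sum.inl p.2)) :=
        sum_le_sum fun e _ => hload e
    _ = ∑ j ∈ T, ∑ e, amt e * traversals (wk e) (Sum.inl j) (Sum.inr j) +
        ∑ p ∈ cutPairs G T, ∑ e, amt e * traversals (wk e) (Sum.inl p.1) (Sum.inl p.2) := by
        rw [sum_add_distrib, sum_comm, sum_comm (s := univ) (t := cutPairs G T)]
    _ ≤ ∑ j ∈ T, (3 : ℝ) + ∑ p ∈ cutPairs G T, (1 : ℝ) := by
        refine add_le_add (sum_le_sum fun j _ => ?_) (sum_le_sum fun p hp => ?_)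
        · simpa [mbCap] using hcap (Sum.inl j) (Sum.inr j)
        · have hadj : G.Adj p.1 p.2 := (mem_filter.1 hp).2.1
          simpa [mbCap, hadj] using hcap (Sum.inl p.1) (Sum.inl p.2)
    _ = 3 * T.card + (cutPairs G T).card := by
        simp [mul_comm]

lemma card_cutPairs_filter_fst_le {I : Type*} [Fintype I] [DecidableEq I] (G : SimpleGraph I)
    [DecidableRel G.Adj] (T : Finset I) (a : I) :
    ((cutPairs G T).filter fun p => p.1 = a).card ≤ G.degree a := by
  rw [← G.card_neighborFinset_eq_degree]
  refine card_le_card_of_injOn Prod.snd ?_ ?_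
  · rintro ⟨x, y⟩ h
    simp at h ⊢
    obtain ⟨h, rfl⟩ := h
    exact h.1
  · rintro ⟨x, y⟩ h ⟨x', y'⟩ h' hxy
    simp at h h' hxy
    simp [h.2, h'.2, hxy]

lemma card_cutPairs_filter_snd_le {I : Type*} [Fintype I] [DecidableEq I] (G : SimpleGraph I)
    [DecidableRel G.Adj] (T : Finset I) (a : I) :
    ((cutPairs G T).filter fun p => p.2 = a).card ≤ G.degree a := by
  rw [← G.card_neighborFinset_eq_degree]
  refine card_le_card_of_injOn Prod.fst ?_ ?_
  · rintro ⟨x, y⟩ h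
    simp at h ⊢
    obtain ⟨h, rfl⟩ := h
    exact h.1.symm
  · rintro ⟨x, y⟩ h ⟨x', y'⟩ h' hxy
    simp at h h' hxy
    simp [h.2, h'.2, hxy]

section OptimalFlow

variable {I : Type*} [Fintype I] [DecidableEq I] (G : SimpleGraph I) [DecidableRel G.Adj]
  (T : Finset I)

/-- Index type of the optimal flow: one path `u_i, w_i` for each `i ∈ T`, and one path
`u_j, u_i, w_i` for each cut pair `(j, i)`. -/
abbrev FlowIndex : Type _ := T ⊕ cutPairs G T

/-- Commodity of each path of the optimal flow. -/
def flowCom : FlowIndex G T → I × I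
  | .inl i => (i, i)
  | .inr p => p

/-- The paths of the optimal flow. -/
def flowWalk : FlowIndex G T → List (I ⊕ I)
  | .inl i => [.inl i, .inr i]
  | .inr p => [.inl p.1.1, .inl p.1.2, .inr p.1.2]

/-- Processing vertices of the optimal flow: the first vertex of each path. -/
def flowProc : FlowIndex G T → I ⊕ I
  | .inl i => .inl i
  | .inr p => .inl p.1.1

/-- Amounts of the optimal flow. -/
def flowAmt : FlowIndex G T → ℝ
  | .inl _ => 3
  | .inr _ => 1

lemma flow_valid (e : FlowIndex G T) :
    2 ≤ (flowWalk G T e).length ∧ (flowWalk G T e).IsChain (mbAdj G) ∧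
      (flowWalk G T e).head? = some (Sum.inl (flowCom G T e).1) ∧
      (flowWalk G T e).getLast? = some (Sum.inr (flowCom G T e).2) ∧
      flowProc G T e ∈ flowWalk G T e ∧ 0 ≤ flowAmt G T e := by
  rcases e with i | ⟨p, hp⟩
  · simp [flowWalk, flowCom, flowProc, flowAmt, mbAdj]
  · have hadj : G.Adj p.1 p.2 := (mem_filter.1 hp).2.1
    simp [flowWalk, flowCom, flowProc, flowAmt, mbAdj, hadj]

/-- Sums over the paths of the optimal flow split into the two kinds of paths. -/
lemma sum_flowIndex (f : I → ℝ) (g : I × I → ℝ) (F : FlowIndex G T → ℝ)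
    (hf : ∀ i, F (.inl i) = f i) (hg : ∀ p, F (.inr p) = g p) :
    ∑ e, F e = ∑ i ∈ T, f i + ∑ p ∈ cutPairs G T, g p := by
  rw [Fintype.sum_sum_type, ← sum_coe_sort T, ← sum_coe_sort (cutPairs G T)]
  simp only [hf, hg]

lemma flow_demand (j i : I) :
    ∑ e ∈ univ.filter (fun e => flowCom G T e = (j, i)), flowAmt G T e ≤ 3 := by
  rw [sum_filter, sum_flowIndex G T (fun a => if (a, a) = (j, i) then 3 else 0)
    (fun p => if p = (j, i) then 1 else 0) _ (fun _ => rfl) (fun _ => rfl), sum_ite_eq']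
  by_cases hji : j = i
  · subst hji
    have : (j, j) ∉ cutPairs G T := by simp
    rw [if_neg this]
    simp only [Prod.mk.injEq, and_self, sum_ite_eq']
    split_ifs <;> norm_num
  · rw [sum_eq_zero]
    · split_ifs <;> norm_num
    · intro a _
      rw [if_neg]
      rintro h
      simp only [Prod.mk.injEq] at h
      exact hji (h.1.symm.trans h.2)

lemma flow_edge (hreg : ∀ v, G.degree v = 3) (x y : I ⊕ I) :
    ∑ e, flowAmt G T e * traversals (flowWalk G T e) x y ≤ mbCap G x y := by
  rw [sum_flowIndex G T
    (fun i => 3 * traversals [Sum.inl i, Sum.inr i] x y)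
    (fun p => 1 * traversals [Sum.inl p.1, Sum.inl p.2, Sum.inr p.2] x y) _
    (fun _ => rfl) (fun _ => rfl)]
  have hpendant : ∀ a b : I,
      ∑ i ∈ T, 3 * traversals [Sum.inl i, Sum.inr i] (Sum.inl a) (Sum.inr b) +
      ∑ p ∈ cutPairs G T, 1 * traversals [Sum.inl p.1, Sum.inl p.2, Sum.inr p.2]
        (Sum.inl a) (Sum.inr b) ≤ if a = b then (3 : ℝ) else 0 := by
    intro a b
    simp only [traversals_inl_inr_inl_inr, traversals_inl_inl_inr_inl_inr]
    by_cases hab : a = b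
    · subst hab
      simp only [and_self, mul_ite, mul_one, mul_zero, sum_ite_eq', sum_boole, if_true]
      by_cases ha : a ∈ T
      · have h : ((cutPairs G T).filter fun p => p.2 = a) = ∅ :=
          filter_eq_empty_iff.2 fun p hp hpa => (mem_filter.1 hp).2.2.2 (hpa ▸ ha)
        rw [if_pos ha, h]
        simp
      · have h : (((cutPairs G T).filter fun p => p.2 = a).card : ℝ) ≤ 3 := by
          exact_mod_cast (card_cutPairs_filter_snd_le G T a).trans_eq (hreg a)
        rw [if_neg ha]
        linarith
    · have h : ∀ i : I, ¬(i = a ∧ i = b) := fun i hi => hab (hi.1.symm.trans hi.2)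
      simp [h, hab]
  rcases x with a | a <;> rcases y with b | b
  · simp only [traversals_inl_inr_inl_inl, traversals_inl_inl_inr_inl_inl, mul_zero,
      sum_const_zero, zero_add, one_mul, sum_add_distrib, sum_ite_eq', mbCap]
    by_cases hadj : G.Adj a b
    · by_cases ha : a ∈ T <;> by_cases hb : b ∈ T <;> simp [hadj, hadj.symm, ha, hb]
    · have hadj' : ¬G.Adj b a := fun h => hadj h.symm
      simp [hadj, hadj']
  · exact hpendant a b
  · have h := hpendant b a
    simp only [traversals_comm _ (Sum.inr a), mbCap, eq_comm (a := a)]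
    exact h
  · simp [traversals, mbCap]

lemma flow_processing (hreg : ∀ v, G.degree v = 3) (n : ℕ) (hn : T.Nonempty → 2 ≤ n)
    (x : I ⊕ I) :
    ∑ e ∈ univ.filter (fun e => flowProc G T e = x), flowAmt G T e ≤ mbProcCap T n x := by
  rw [sum_filter, sum_flowIndex G T (fun a => if Sum.inl a = x then 3 else 0)
    (fun p => if Sum.inl p.1 = x then 1 else 0) _ (fun _ => rfl) (fun _ => rfl)]
  rcases x with a | a
  · simp only [Sum.inl.injEq, sum_ite_eq', mbProcCap]
    rw [sum_boole]
    by_cases ha : a ∈ T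
    · have h₁ : (((cutPairs G T).filter fun p => p.1 = a).card : ℝ) ≤ 3 := by
        exact_mod_cast (card_cutPairs_filter_fst_le G T a).trans_eq (hreg a)
      have h₂ : (2 : ℝ) ≤ n := by exact_mod_cast hn ⟨a, ha⟩
      rw [if_pos ha, if_pos ha]
      linarith
    · have h : ((cutPairs G T).filter fun p => p.1 = a) = ∅ := by
        refine filter_eq_empty_iff.2 fun p hp hpa => ha ?_
        exact hpa ▸ (mem_filter.1 hp).2.2.1
      rw [if_neg ha, if_neg ha, h]
      simp
  · simp [mbProcCap]

lemma flow_total : ∑ e, flowAmt G T e = 3 * T.card + (cutPairs G T).card := by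
  rw [sum_flowIndex G T (fun _ => 3) (fun _ => 1) _ (fun _ => rfl) (fun _ => rfl)]
  simp [mul_comm]

end OptimalFlow

theorem stmt13 {I : Type*} [Fintype I] [DecidableEq I]
    (G : SimpleGraph I) [DecidableRel G.Adj]
    (hreg : ∀ v, G.degree v = 3) (heven : Even (Fintype.card I))
    (T : Finset I) (hT : 2 * T.card = Fintype.card I) :
    IsGreatest
      {r : ℝ | ∃ (k : ℕ) (com : Fin k → I × I) (wk : Fin k → List (I ⊕ I))
          (proc : Fin k → I ⊕ I) (amt : Fin k → ℝ),
        -- each triple is valid: a walk in the network from `u_j` to `w_i` for the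
        -- commodity `(j, i)`, a processing vertex that is an entry of the walk,
        -- and a nonnegative amount
        (∀ e, 2 ≤ (wk e).length ∧ (wk e).Chain' (mbAdj G) ∧
          (wk e).head? = some (Sum.inl (com e).1) ∧
          (wk e).getLast? = some (Sum.inr (com e).2) ∧
          proc e ∈ wk e ∧ 0 ≤ amt e) ∧
        -- each commodity `(j, i)` routes at most its demand of 3 units
        (∀ j i, ∑ e ∈ univ.filter (fun e => com e = (j, i)), amt e ≤ 3) ∧
        -- edge capacities: the total traversal load (in either direction,
        -- with multiplicity) is at most the capacity
        (∀ x y : I ⊕ I,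
          ∑ e, amt e * ((((wk e).zip (wk e).tail).count (x, y) : ℝ) +
            (((wk e).zip (wk e).tail).count (y, x) : ℝ)) ≤ mbCap G x y) ∧
        -- vertex capacities: total processing at each vertex is at most its capacity
        (∀ x, ∑ e ∈ univ.filter (fun e => proc e = x), amt e ≤
          mbProcCap T (Fintype.card I) x) ∧
        -- `r` is the total routed flow
        ∑ e, amt e = r}
      (3 * (Fintype.card I : ℝ) / 2 +
        ((univ : Finset (I × I)).filter
          (fun e => G.Adj e.1 e.2 ∧ e.1 ∈ T ∧ e.2 ∉ T)).card) := by
  have hcard : 3 * (Fintype.card I : ℝ) / 2 = 3 * T.card := by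
    rw [← hT]
    push_cast
    ring
  rw [hcard]
  constructor
  · have hn : T.Nonempty → 2 ≤ Fintype.card I := fun h => by
      have := h.card_pos
      omega
    let σ := (Fintype.equivFin (FlowIndex G T)).symm
    refine ⟨_, flowCom G T ∘ σ, flowWalk G T ∘ σ, flowProc G T ∘ σ, flowAmt G T ∘ σ,
      fun e => flow_valid G T (σ e), fun j i => ?_, fun x y => ?_, fun x => ?_, ?_⟩
    · refine le_of_eq_of_le ?_ (flow_demand G T j i)
      rw [sum_filter, sum_filter]
      exact σ.sum_comp fun e => if flowCom G T e = (j, i) then flowAmt G T e else 0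
    · refine le_of_eq_of_le ?_ (flow_edge G T hreg x y)
      exact σ.sum_comp fun e => flowAmt G T e * traversals (flowWalk G T e) x y
    · refine le_of_eq_of_le ?_ (flow_processing G T hreg _ hn x)
      rw [sum_filter, sum_filter]
      exact σ.sum_comp fun e => if flowProc G T e = x then flowAmt G T e else 0
    · exact (σ.sum_comp (flowAmt G T)).trans (flow_total G T)
  · rintro r ⟨k, com, wk, proc, amt, hvalid, -, hcap, hpcap, rfl⟩
    exact sum_le_of_feasible G T _ com wk proc amt (fun e => (hvalid e).2.1)
      (fun e => (hvalid e).2.2.2.1) (fun e => (hvalid e).2.2.2.2.1)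
      (fun e => (hvalid e).2.2.2.2.2) hcap hpcap
end

section
/- Let V be a finite vertex set, t ∈ V a sink, B : V × V → ℝ nonnegative edge capacities, and c : V → ℝ nonnegative supply bounds. For S ⊆ V ∖ {t}, call f : V × V → ℝ an S-supplied flow if 0 ≤ f(u,v) ≤ B(u,v) for all u, v; Σ_u f(u,v) = Σ_u f(v,u) for every v ∉ S ∪ {t}; and 0 ≤ Σ_u f(v,u) − Σ_u f(u,v) ≤ c(v) for every v ∈ S. Define F(S) as the supremum over S-supplied flows f of the net inflow at t, namely Σ_u f(u,t) − Σ_u f(t,u). Then F is monotone, i.e., F(S) ≤ F(S') whenever S ⊆ S' ⊆ V ∖ {t}, and submodular, i.e., F(S ∪ {x}) − F(S) ≥ F(S' ∪ {x}) − F(S') whenever S ⊆ S' ⊆ V ∖ {t} and x ∈ V ∖ {t} with x ∉ S'. -/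
open Finset

/-- An `S`-supplied flow: capacities are respected, flow is conserved at every vertex
outside `S ∪ {t}`, and every vertex of `S` has a net outflow between `0` and `c v`. -/
def IsSuppliedFlow {V : Type*} [Fintype V] (t : V) (B : V → V → ℝ) (c : V → ℝ)
    (S : Set V) (f : V → V → ℝ) : Prop :=
  (∀ u v, 0 ≤ f u v ∧ f u v ≤ B u v) ∧
  (∀ v, v ∉ S → v ≠ t → ∑ u, f u v = ∑ u, f v u) ∧
  (∀ v ∈ S, 0 ≤ ∑ u, f v u - ∑ u, f u v ∧ ∑ u, f v u - ∑ u, f u v ≤ c v)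

/-- `maxInflow t B c S` is the supremum over `S`-supplied flows of the net inflow
at the sink `t`. -/
noncomputable def maxInflow {V : Type*} [Fintype V] (t : V) (B : V → V → ℝ)
    (c : V → ℝ) (S : Set V) : ℝ :=
  sSup {r : ℝ | ∃ f, IsSuppliedFlow t B c S f ∧ r = ∑ u, f u t - ∑ u, f t u}

/-- The net outflow of `f` at `v`. -/
def netOutflow {V : Type*} [Fintype V] (f : V → V → ℝ) (v : V) : ℝ :=
  ∑ u, f v u - ∑ u, f u v

open Classical in
/-- The capacity of the cut with sink side `T`: the capacity of the edges entering `T` plus the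
supply available inside `T`. -/
noncomputable def cutCapacity {V : Type*} [Fintype V] (B : V → V → ℝ) (c : V → ℝ)
    (S T : Set V) : ℝ :=
  ∑ v, ∑ u, (if v ∈ T ∧ u ∉ T then B u v else 0) + ∑ v, if v ∈ T ∧ v ∈ S then c v else 0

theorem combo_mem_capacity {V : Type*} {B : V → V → ℝ} {a : ℝ} {g h : V → V → ℝ}
    (ha : 0 ≤ a) (ha' : a ≤ 1) (hg : ∀ p q, 0 ≤ g p q ∧ g p q ≤ B p q)
    (hh : ∀ p q, 0 ≤ h p q ∧ h p q ≤ B p q) (p q : V) :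
    0 ≤ a * g p q + (1 - a) * h p q ∧ a * g p q + (1 - a) * h p q ≤ B p q := by
  have hb : 0 ≤ 1 - a := by linarith
  constructor
  · have := mul_nonneg ha (hg p q).1
    have := mul_nonneg hb (hh p q).1
    linarith
  · have := mul_le_mul_of_nonneg_left (hg p q).2 ha
    have := mul_le_mul_of_nonneg_left (hh p q).2 hb
    linarith

section MaxFlowMinCut

variable {V : Type*} [Fintype V] {t : V} {B : V → V → ℝ} {c : V → ℝ} {S S' T T' : Set V}
  {f : V → V → ℝ}

open Classical in
theorem sum_netOutflow_eq_crossing (f : V → V → ℝ) (T : Set V) :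
    ∑ v, (if v ∈ T then netOutflow f v else 0) =
      ∑ v, ∑ u, if v ∈ T ∧ u ∉ T then f v u - f u v else 0 := by
  have inside : ∑ v, ∑ u, (if v ∈ T ∧ u ∈ T then f v u - f u v else 0) = 0 := by
    have anti : ∑ v, ∑ u, (if v ∈ T ∧ u ∈ T then f v u - f u v else 0) =
        -∑ v, ∑ u, (if v ∈ T ∧ u ∈ T then f v u - f u v else 0) := by
      conv_lhs => rw [sum_comm]
      simp only [← sum_neg_distrib]
      refine sum_congr rfl fun v _ => sum_congr rfl fun u _ => ?_
      by_cases hv : v ∈ T <;> by_cases hu : u ∈ T <;> simp [hu, hv]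
    linarith
  refine sub_eq_zero.1 (Eq.trans ?_ inside)
  rw [← sum_sub_distrib]
  refine sum_congr rfl fun v _ => ?_
  by_cases hv : v ∈ T
  · simp only [hv, if_true, true_and, netOutflow, ← sum_sub_distrib]
    refine sum_congr rfl fun u _ => ?_
    by_cases hu : u ∈ T <;> simp [hu]
  · simp [hv]

open Classical in
theorem IsSuppliedFlow.inflow_eq (hf : IsSuppliedFlow t B c S f) (hS : t ∉ S) (hT : t ∈ T) :
    ∑ u, f u t - ∑ u, f t u =
      ∑ v, ∑ u, (if v ∈ T ∧ u ∉ T then f u v - f v u else 0) +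
        ∑ v, if v ∈ T ∧ v ∈ S then netOutflow f v else 0 := by
  have split : ∑ v, (if v ∈ T then netOutflow f v else 0) =
      ∑ v, (if v = t then netOutflow f v else 0) +
        ∑ v, if v ∈ T ∧ v ∈ S then netOutflow f v else 0 := by
    rw [← sum_add_distrib]
    refine sum_congr rfl fun v _ => ?_
    by_cases hvt : v = t
    · subst hvt
      simp [hS, hT]
    · by_cases hvS : v ∈ S
      · simp [hvt, hvS]
      · simp [hvt, hvS, netOutflow, hf.2.1 v hvS hvt]
  have flip : ∑ v, ∑ u, (if v ∈ T ∧ u ∉ T then f u v - f v u else 0) =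
      -∑ v, ∑ u, (if v ∈ T ∧ u ∉ T then f v u - f u v else 0) := by
    simp only [← sum_neg_distrib]
    refine sum_congr rfl fun v _ => sum_congr rfl fun u _ => ?_
    split_ifs <;> simp
  rw [sum_netOutflow_eq_crossing] at split
  simp only [sum_ite_eq', mem_univ, if_true] at split
  rw [flip, split, netOutflow]
  ring

theorem IsSuppliedFlow.inflow_le_cutCapacity (hf : IsSuppliedFlow t B c S f) (hS : t ∉ S)
    (hT : t ∈ T) : ∑ u, f u t - ∑ u, f t u ≤ cutCapacity B c S T := by
  classical
  rw [hf.inflow_eq hS hT, cutCapacity]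
  gcongr with v _ u _ v _
  · split_ifs
    · linarith [(hf.1 u v).2, (hf.1 v u).1]
    · rfl
  · split_ifs with h
    · exact (hf.2.2 v h.2).2
    · rfl

theorem isSuppliedFlow_zero (hB : ∀ u v, 0 ≤ B u v) (hc : ∀ v, 0 ≤ c v) :
    IsSuppliedFlow t B c S 0 := by
  simp [IsSuppliedFlow, hB, hc]

theorem isCompact_setOf_isSuppliedFlow (t : V) (B : V → V → ℝ) (c : V → ℝ) (S : Set V) :
    IsCompact {f | IsSuppliedFlow t B c S f} := by
  refine (isCompact_Icc (a := (0 : V → V → ℝ)) (b := B)).of_isClosed_subset ?_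
    fun f hf => ⟨fun u v => (hf.1 u v).1, fun u v => (hf.1 u v).2⟩
  simp only [IsSuppliedFlow, Set.ofPred_and, Set.ofPred_forall]
  refine .inter ?_ (.inter ?_ ?_)
  · exact isClosed_iInter fun u => isClosed_iInter fun v =>
      (isClosed_le (by fun_prop) (by fun_prop)).inter (isClosed_le (by fun_prop) (by fun_prop))
  · exact isClosed_iInter fun v => isClosed_iInter fun _ => isClosed_iInter fun _ =>
      isClosed_eq (by fun_prop) (by fun_prop)
  · exact isClosed_iInter fun v => isClosed_iInter fun _ =>
      (isClosed_le (by fun_prop) (by fun_prop)).inter (isClosed_le (by fun_prop) (by fun_prop))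

theorem exists_isSuppliedFlow_isMax (t : V) (S : Set V) (hB : ∀ u v, 0 ≤ B u v)
    (hc : ∀ v, 0 ≤ c v) :
    ∃ f, IsSuppliedFlow t B c S f ∧ ∀ g, IsSuppliedFlow t B c S g →
      ∑ u, g u t - ∑ u, g t u ≤ ∑ u, f u t - ∑ u, f t u := by
  obtain ⟨f, hf, hmax⟩ := (isCompact_setOf_isSuppliedFlow t B c S).exists_isMaxOn
    ⟨0, isSuppliedFlow_zero hB hc⟩
    (f := fun f : V → V → ℝ => ∑ u, f u t - ∑ u, f t u) (by fun_prop)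
  exact ⟨f, hf, fun g hg => hmax hg⟩

theorem netOutflow_combo (a b : ℝ) (f g : V → V → ℝ) (w : V) :
    netOutflow (fun u v => a * f u v + b * g u v) w =
      a * netOutflow f w + b * netOutflow g w := by
  simp only [netOutflow, sum_add_distrib, ← mul_sum]
  ring

open Classical in
theorem netOutflow_single (p q : V) (η : ℝ) (w : V) :
    netOutflow (fun u v => if u = p ∧ v = q then η else 0) w =
      η * ((if w = p then 1 else 0) - if w = q then 1 else 0) := by
  simp only [netOutflow, ite_and, sum_ite_eq', sum_ite_irrel, sum_const_zero, mem_univ, if_true]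
  split_ifs <;> ring

open Classical in
/-- Some positive amount of flow can be pushed from `v` to `t` on top of `f` within the
capacities `B`. -/
def CanPush (t : V) (B f : V → V → ℝ) (v : V) : Prop :=
  ∃ ε > 0, ∃ g : V → V → ℝ, (∀ p q, 0 ≤ g p q ∧ g p q ≤ B p q) ∧
    ∀ w, netOutflow g w =
      netOutflow f w + ε * ((if w = v then 1 else 0) - if w = t then 1 else 0)

open Classical in
theorem CanPush.trans {u v : V} (hv : CanPush t B f v) {η : ℝ} (hη : 0 < η) {h : V → V → ℝ}
    (hh : ∀ p q, 0 ≤ h p q ∧ h p q ≤ B p q)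
    (hnet : ∀ w, netOutflow h w =
      netOutflow f w + η * ((if w = u then 1 else 0) - if w = v then 1 else 0)) :
    CanPush t B f u := by
  obtain ⟨ε, hε, g, hg, hgnet⟩ := hv
  have hpos : 0 < ε + η := by linarith
  refine ⟨ε * η / (ε + η), by positivity, _,
    combo_mem_capacity (a := η / (ε + η)) (by positivity)
      ((div_le_one hpos).2 (by linarith)) hg hh, fun w => ?_⟩
  rw [netOutflow_combo, hgnet, hnet]
  field_simp
  ring

theorem CanPush.of_edge_lt {u v : V} (hv : CanPush t B f v)
    (hf : ∀ p q, 0 ≤ f p q ∧ f p q ≤ B p q) (huv : f u v < B u v) : CanPush t B f u := by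
  classical
  refine hv.trans (sub_pos.2 huv)
    (h := fun p q => 1 * f p q + 1 * if p = u ∧ q = v then B u v - f u v else 0)
    (fun p q => ?_) fun w => ?_
  · have := hf p q
    split_ifs with h
    · obtain ⟨rfl, rfl⟩ := h
      constructor <;> linarith
    · simpa using this
  · rw [netOutflow_combo, netOutflow_single]
    ring

theorem CanPush.of_edge_pos {u v : V} (hv : CanPush t B f v)
    (hf : ∀ p q, 0 ≤ f p q ∧ f p q ≤ B p q) (hvu : 0 < f v u) : CanPush t B f u := by
  classical
  refine hv.trans hvu
    (h := fun p q => 1 * f p q + (-1) * if p = v ∧ q = u then f v u else 0)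
    (fun p q => ?_) fun w => ?_
  · have := hf p q
    split_ifs with h
    · obtain ⟨rfl, rfl⟩ := h
      constructor <;> linarith
    · simpa using this
  · rw [netOutflow_combo, netOutflow_single]
    ring

theorem IsSuppliedFlow.exists_inflow_lt {v : V} (hf : IsSuppliedFlow t B c S f) (hS : t ∉ S)
    (hvS : v ∈ S) (hlt : netOutflow f v < c v) (hv : CanPush t B f v) :
    ∃ g, IsSuppliedFlow t B c S g ∧
      ∑ u, f u t - ∑ u, f t u < ∑ u, g u t - ∑ u, g t u := by
  classical
  obtain ⟨ε, hε, g, hg, hgnet⟩ := hv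
  have hvt : v ≠ t := fun h => hS (h ▸ hvS)
  set δ := c v - netOutflow f v
  have hδ : 0 < δ := sub_pos.2 hlt
  have hpos : 0 < ε + δ := by linarith
  set a := δ / (ε + δ) with ha
  have ha0 : 0 < a := by positivity
  have ha1 : a ≤ 1 := (div_le_one hpos).2 (by linarith)
  have haε : a * ε ≤ δ := by
    rw [ha, div_mul_eq_mul_div, div_le_iff₀ hpos]
    nlinarith
  have haε0 : 0 < a * ε := by positivity
  have hnet (w : V) : netOutflow (fun p q => a * g p q + (1 - a) * f p q) w =
      netOutflow f w + a * ε * ((if w = v then 1 else 0) - if w = t then 1 else 0) := by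
    rw [netOutflow_combo, hgnet]
    ring
  refine ⟨fun p q => a * g p q + (1 - a) * f p q,
    ⟨combo_mem_capacity ha0.le ha1 hg hf.1, fun w hwS hwt => ?_, fun w hw => ?_⟩, ?_⟩
  · have hwv : w ≠ v := fun h => hwS (h ▸ hvS)
    have h1 := hnet w
    have h2 := hf.2.1 w hwS hwt
    simp only [hwv, hwt, if_false, netOutflow] at h1
    linarith
  · have hwt : w ≠ t := fun h => hS (h ▸ hw)
    have h1 := hnet w
    have h2 : 0 ≤ netOutflow f w ∧ netOutflow f w ≤ c w := hf.2.2 w hw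
    change 0 ≤ netOutflow (fun p q => a * g p q + (1 - a) * f p q) w ∧
      netOutflow (fun p q => a * g p q + (1 - a) * f p q) w ≤ c w
    rw [h1]
    by_cases hwv : w = v
    · subst hwv
      simp only [hwt, if_true, if_false]
      constructor <;> linarith
    · simpa [hwt, hwv] using h2
  · have h1 := hnet t
    simp only [hvt.symm, if_true, if_false, netOutflow] at h1
    linarith

theorem maxInflow_le_cutCapacity (hB : ∀ u v, 0 ≤ B u v) (hc : ∀ v, 0 ≤ c v) (hS : t ∉ S)
    (hT : t ∈ T) : maxInflow t B c S ≤ cutCapacity B c S T := by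
  refine csSup_le ⟨_, 0, isSuppliedFlow_zero hB hc, rfl⟩ ?_
  rintro r ⟨f, hf, rfl⟩
  exact hf.inflow_le_cutCapacity hS hT

theorem exists_cutCapacity_le_maxInflow (hB : ∀ u v, 0 ≤ B u v) (hc : ∀ v, 0 ≤ c v)
    (hS : t ∉ S) : ∃ T, t ∈ T ∧ cutCapacity B c S T ≤ maxInflow t B c S := by
  classical
  obtain ⟨f, hf, hmax⟩ := exists_isSuppliedFlow_isMax t S hB hc
  have hT : t ∈ {v | CanPush t B f v} := ⟨1, one_pos, f, hf.1, fun w => by simp⟩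
  refine ⟨{v | CanPush t B f v}, hT, ?_⟩
  calc cutCapacity B c S {v | CanPush t B f v}
      ≤ ∑ u, f u t - ∑ u, f t u := by
        rw [hf.inflow_eq hS hT, cutCapacity]
        gcongr with v _ u _ v _
        · split_ifs with h
          · have h1 : B u v ≤ f u v := not_lt.1 fun hlt => h.2 (h.1.of_edge_lt hf.1 hlt)
            have h2 : f v u ≤ 0 := not_lt.1 fun hlt => h.2 (h.1.of_edge_pos hf.1 hlt)
            linarith
          · rfl
        · split_ifs with h
          · refine not_lt.1 fun hlt => ?_
            obtain ⟨g, hg, hfg⟩ := hf.exists_inflow_lt hS h.2 hlt h.1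
            exact (hmax g hg).not_gt hfg
          · rfl
    _ ≤ maxInflow t B c S := by
        refine le_csSup ⟨∑ u, f u t - ∑ u, f t u, ?_⟩ ⟨f, hf, rfl⟩
        rintro r ⟨g, hg, rfl⟩
        exact hmax g hg

theorem cutCapacity_mono (hc : ∀ v, 0 ≤ c v) (hSS' : S ⊆ S') (T : Set V) :
    cutCapacity B c S T ≤ cutCapacity B c S' T := by
  unfold cutCapacity
  gcongr with v
  have := hc v
  have := @hSS' v
  split_ifs <;> tauto

theorem cutCapacity_inter_add_union_le (hB : ∀ u v, 0 ≤ B u v) (hc : ∀ v, 0 ≤ c v)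
    (S S' T T' : Set V) :
    cutCapacity B c (S ∪ S') (T ∩ T') + cutCapacity B c (S ∩ S') (T ∪ T') ≤
      cutCapacity B c S T + cutCapacity B c S' T' := by
  unfold cutCapacity
  refine ((add_add_add_comm _ _ _ _).trans_le ?_).trans_eq (add_add_add_comm _ _ _ _)
  refine add_le_add ?_ ?_ <;> simp only [← sum_add_distrib]
  · refine sum_le_sum fun v _ => sum_le_sum fun u _ => ?_
    have := hB u v
    by_cases h1 : v ∈ T <;> by_cases h2 : v ∈ T' <;> by_cases h3 : u ∈ T <;>
      by_cases h4 : u ∈ T' <;> simp [h1, h2, h3, h4, this]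
  · refine sum_le_sum fun v _ => ?_
    have := hc v
    by_cases h1 : v ∈ T <;> by_cases h2 : v ∈ T' <;> by_cases h3 : v ∈ S <;>
      by_cases h4 : v ∈ S' <;> simp [h1, h2, h3, h4, this]

end MaxFlowMinCut

theorem stmt15 {V : Type*} [Fintype V] (t : V) (B : V → V → ℝ) (c : V → ℝ)
    (hB : ∀ u v, 0 ≤ B u v) (hc : ∀ v, 0 ≤ c v) :
    -- `maxInflow` is monotone ...
    (∀ S S' : Set V, S ⊆ S' → S' ⊆ {t}ᶜ →
      maxInflow t B c S ≤ maxInflow t B c S') ∧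
    -- ... and submodular
    (∀ S S' : Set V, S ⊆ S' → S' ⊆ {t}ᶜ → ∀ x, x ≠ t → x ∉ S' →
      maxInflow t B c (S' ∪ {x}) - maxInflow t B c S' ≤
        maxInflow t B c (S ∪ {x}) - maxInflow t B c S) := by
  have not_mem {S : Set V} (hS : S ⊆ {t}ᶜ) : t ∉ S := fun h => hS h rfl
  refine ⟨fun S S' hSS' hS' => ?_, fun S S' hSS' hS' x hxt hxS' => ?_⟩
  · obtain ⟨T, hT, hle⟩ := exists_cutCapacity_le_maxInflow hB hc (not_mem hS')
    exact (maxInflow_le_cutCapacity hB hc (not_mem (hSS'.trans hS')) hT).trans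
      ((cutCapacity_mono hc hSS' T).trans hle)
  · have hx : ({x} : Set V) ⊆ {t}ᶜ := Set.singleton_subset_iff.2 hxt
    have hS := hSS'.trans hS'
    obtain ⟨T, hT, hle⟩ :=
      exists_cutCapacity_le_maxInflow hB hc (not_mem (Set.union_subset hS hx))
    obtain ⟨T', hT', hle'⟩ := exists_cutCapacity_le_maxInflow hB hc (not_mem hS')
    have hinter := maxInflow_le_cutCapacity hB hc
      (not_mem (Set.union_subset hS' hx)) (Set.mem_inter hT hT')
    have hunion := maxInflow_le_cutCapacity hB hc (not_mem hS) (Set.mem_union_left T' hT)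
    have hsub := cutCapacity_inter_add_union_le hB hc (S ∪ {x}) S' T T'
    have hcup : S ∪ {x} ∪ S' = S' ∪ {x} := by
      rw [Set.union_right_comm, Set.union_eq_self_of_subset_left hSS']
    have hcap : (S ∪ {x}) ∩ S' = S := by
      rw [Set.union_inter_distrib_right, Set.inter_eq_self_of_subset_left hSS',
        Set.singleton_inter_eq_empty.2 hxS', Set.union_empty]
    rw [hcup, hcap] at hsub
    linarith
end
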